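/- arXiv:2510.26123 — 2 statements merged into one kernel-verified Lean document; each statement's English description precedes it below -/
import Mathlib

section
/- Let X be a non-negative integer-valued random variable with characteristic function φ(t) = 𝔼[e^{itX}]. Suppose there exist c₁ > 0, c₂ ∈ ℂ with Im(c₂) ≠ 0, and ν ∈ (0,1) such that φ(t) = 1 + i·c₁·t + (c₂·𝟙_{t>0} + c̄₂·𝟙_{t<0})·|t|^{1+ν} + o(|t|^{1+ν}) as t → 0. Then necessarily Im(c₂) < 0, and, setting a = −(ν·Im(c₂)/Γ(1−ν))·sec(πν/2) > 0, one has ℙ[X > R] = a·R^{−ν−1} + o(R^{−ν−1}) as R → ∞. -/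
open MeasureTheory Complex Asymptotics Filter Topology

theorem integrable_pow_mul_gaussian (n : ℕ) :
    Integrable fun u : ℝ => u ^ n * Real.exp (-(1 / 2) * u ^ 2) := by
  simpa using integrable_rpow_mul_exp_neg_mul_sq (b := 1 / 2) (by norm_num) (s := n)
    (by have : (0 : ℝ) ≤ n := n.cast_nonneg
        linarith)

theorem integral_gaussian_mul_cos (x : ℝ) :
    ∫ u : ℝ, Real.exp (-(1 / 2) * u ^ 2) * Real.cos (u * x) =
      √(2 * Real.pi) * Real.exp (-(1 / 2) * x ^ 2) := by
  have h := fourierIntegral_gaussian (b := ((1 / 2 : ℝ) : ℂ)) (by norm_num) (x : ℂ)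
  have h2 : ((Real.pi : ℂ) / ((1 / 2 : ℝ) : ℂ)) ^ (1 / 2 : ℂ) = ((√(2 * Real.pi) : ℝ) : ℂ) := by
    rw [Real.sqrt_eq_rpow, ofReal_cpow (by positivity)]
    push_cast
    congr 1
    ring
  rw [h2] at h
  have h3 : cexp (-(x : ℂ) ^ 2 / (4 * ((1 / 2 : ℝ) : ℂ))) =
      ((Real.exp (-(1 / 2) * x ^ 2) : ℝ) : ℂ) := by
    push_cast
    congr 1
    ring
  rw [h3, ← ofReal_mul] at h
  have hint : Integrable fun u : ℝ =>
      cexp (I * x * u) * cexp (-((1 / 2 : ℝ) : ℂ) * (u : ℂ) ^ 2) := by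
    by_contra hc
    rw [integral_undef hc] at h
    have : (0 : ℝ) < √(2 * Real.pi) * Real.exp (-(1 / 2) * x ^ 2) := by positivity
    exact this.ne (ofReal_injective (by simpa using h))
  have h4 := congrArg re h
  rw [ofReal_re] at h4
  rw [← h4]
  have h5 := reCLM.integral_comp_comm hint
  simp only [reCLM_apply] at h5
  rw [← h5]
  congr 1
  ext u
  have e1 : -((1 / 2 : ℝ) : ℂ) * (u : ℂ) ^ 2 = ((-(1 / 2) * u ^ 2 : ℝ) : ℂ) := by
    push_cast; ring
  have e2 : I * x * u = ((u * x : ℝ) : ℂ) * I := by push_cast; ring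
  rw [e1, ← ofReal_exp, re_mul_ofReal, e2, exp_ofReal_mul_I_re, mul_comm]

theorem hasDerivAt_gaussian (u : ℝ) : HasDerivAt (fun u : ℝ => Real.exp (-(1 / 2) * u ^ 2))
    (-(u * Real.exp (-(1 / 2) * u ^ 2))) u := by
  have := (((hasDerivAt_id u).pow 2).const_mul (-(1 / 2 : ℝ))).exp
  refine this.congr_deriv ?_
  simp
  ring

theorem integral_cubic_gaussian_mul_sin (x : ℝ) :
    ∫ u : ℝ, (3 * u - u ^ 3) * Real.exp (-(1 / 2) * u ^ 2) * Real.sin (u * x) =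
      √(2 * Real.pi) * (x ^ 3 * Real.exp (-(1 / 2) * x ^ 2)) := by
  set E : ℝ → ℝ := fun u => Real.exp (-(1 / 2) * u ^ 2) with hE
  have hE' : ∀ u, HasDerivAt E (-(u * E u)) u := hasDerivAt_gaussian
  have hs : ∀ u, HasDerivAt (fun u : ℝ => Real.sin (u * x)) (Real.cos (u * x) * x) u := fun u => by
    simpa using ((hasDerivAt_id u).mul_const x).sin
  have hc : ∀ u, HasDerivAt (fun u : ℝ => Real.cos (u * x)) (-Real.sin (u * x) * x) u := fun u => by
    simpa using ((hasDerivAt_id u).mul_const x).cos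
  have i0 : Integrable E := by simpa [E] using integrable_pow_mul_gaussian 0
  have i1 : Integrable fun u => u * E u := by simpa [E] using integrable_pow_mul_gaussian 1
  have i2 : Integrable fun u => u ^ 2 * E u := integrable_pow_mul_gaussian 2
  have i3 : Integrable fun u => u ^ 3 * E u := integrable_pow_mul_gaussian 3
  have i2' : Integrable fun u => (u ^ 2 - 1) * E u := by
    refine (i2.sub i0).congr (.of_forall fun u => ?_)
    simp; ring
  have i3' : Integrable fun u => (3 * u - u ^ 3) * E u := by
    refine ((i1.const_mul 3).sub i3).congr (.of_forall fun u => ?_)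
    simp; ring
  have bs : ∀ f : ℝ → ℝ, Integrable f → Integrable fun u => f u * Real.sin (u * x) := fun f hf =>
    hf.mul_bdd (c := 1) (by fun_prop) (.of_forall fun u => Real.abs_sin_le_one _)
  have bc : ∀ f : ℝ → ℝ, Integrable f → Integrable fun u => f u * Real.cos (u * x) := fun f hf =>
    hf.mul_bdd (c := 1) (by fun_prop) (.of_forall fun u => Real.abs_cos_le_one _)
  have d1 : ∀ u, HasDerivAt (fun u => u * E u) (-((u ^ 2 - 1) * E u)) u := fun u =>
    ((hasDerivAt_id u).mul (hE' u)).congr_deriv (by simp; ring)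
  have d2 : ∀ u, HasDerivAt (fun u => (u ^ 2 - 1) * E u) ((3 * u - u ^ 3) * E u) u := fun u =>
    ((((hasDerivAt_id u).pow 2).sub_const 1).mul (hE' u)).congr_deriv (by simp; ring)
  have s1 := integral_mul_deriv_eq_deriv_mul_of_integrable (fun u _ => hE' u) (fun u _ => hs u)
    (((bc _ i0).mul_const x).congr (.of_forall fun u => by simp; ring))
    ((bs _ i1).neg.congr (.of_forall fun u => by simp)) (bs _ i0)
  have s2 := integral_mul_deriv_eq_deriv_mul_of_integrable (fun u _ => d1 u) (fun u _ => hc u)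
    (((bs _ i1).neg.mul_const x).congr (.of_forall fun u => by simp; ring))
    ((bc _ i2').neg.congr (.of_forall fun u => by simp)) (bc _ i1)
  have s3 := integral_mul_deriv_eq_deriv_mul_of_integrable (fun u _ => d2 u) (fun u _ => hs u)
    (((bc _ i2').mul_const x).congr (.of_forall fun u => by simp; ring))
    (bs _ i3') (bs _ i2')
  have hA := integral_gaussian_mul_cos x
  simp only [neg_mul, mul_neg, integral_neg, neg_neg, ← mul_assoc, integral_mul_const] at s1 s2 s3
  have hA' : ∫ u, E u * Real.cos (u * x) = √(2 * Real.pi) * E x := hA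
  rw [hA'] at s1
  change _ = √(2 * Real.pi) * (x ^ 3 * E x)
  linear_combination s3 + x * s2 - x ^ 2 * s1

theorem integrable_cubic_gaussian :
    Integrable fun u : ℝ => (3 * u - u ^ 3) * Real.exp (-(1 / 2) * u ^ 2) := by
  refine (((integrable_pow_mul_gaussian 1).const_mul 3).sub
    (integrable_pow_mul_gaussian 3)).congr (.of_forall fun u => ?_)
  simp; ring

theorem integral_Ioi_cubic_gaussian_mul_sin (x : ℝ) :
    ∫ u in Set.Ioi (0 : ℝ), (3 * u - u ^ 3) * Real.exp (-(1 / 2) * u ^ 2) * Real.sin (u * x) =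
      √(2 * Real.pi) / 2 * (x ^ 3 * Real.exp (-(1 / 2) * x ^ 2)) := by
  have h := integral_cubic_gaussian_mul_sin x
  have h2 := integral_comp_abs (f := fun u : ℝ =>
    (3 * u - u ^ 3) * Real.exp (-(1 / 2) * u ^ 2) * Real.sin (u * x))
  have h3 : ∀ u : ℝ, (3 * |u| - |u| ^ 3) * Real.exp (-(1 / 2) * |u| ^ 2) * Real.sin (|u| * x) =
      (3 * u - u ^ 3) * Real.exp (-(1 / 2) * u ^ 2) * Real.sin (u * x) := fun u => by
    rcases abs_choice u with hu | hu <;> rw [hu]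
    rw [neg_mul u, Real.sin_neg]
    ring_nf
  simp only [h3] at h2
  linarith

theorem integral_rpow_mul_gaussian {q : ℝ} (hq : -1 < q) :
    ∫ u in Set.Ioi (0 : ℝ), u ^ q * Real.exp (-(1 / 2) * u ^ 2) =
      2 ^ ((q - 1) / 2) * Real.Gamma ((q + 1) / 2) := by
  have h := integral_rpow_mul_exp_neg_mul_rpow (p := 2) (q := q) (b := 1 / 2) (by norm_num) hq
    (by norm_num)
  simp only [Real.rpow_two] at h
  rw [h]
  congr 1
  rw [one_div, Real.inv_rpow (by norm_num), ← Real.rpow_neg (by norm_num),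
    ← Real.rpow_neg_one 2, ← Real.rpow_add (by norm_num)]
  congr 1
  ring

theorem integral_cubic_gaussian_mul_rpow {p : ℝ} (hp : 0 < p) :
    ∫ u in Set.Ioi (0 : ℝ), (3 * u - u ^ 3) * Real.exp (-(1 / 2) * u ^ 2) * u ^ p =
      (1 - p) * (2 ^ (p / 2) * Real.Gamma (p / 2 + 1)) := by
  have e : ∀ u ∈ Set.Ioi (0 : ℝ), (3 * u - u ^ 3) * Real.exp (-(1 / 2) * u ^ 2) * u ^ p =
      3 * (u ^ (p + 1) * Real.exp (-(1 / 2) * u ^ 2)) -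
        u ^ (p + 3) * Real.exp (-(1 / 2) * u ^ 2) := fun u hu => by
    rw [Real.rpow_add hu, Real.rpow_add hu, Real.rpow_one, show (3 : ℝ) = (3 : ℕ) by norm_num,
      Real.rpow_natCast]
    push_cast; ring
  rw [setIntegral_congr_fun measurableSet_Ioi e, integral_sub, integral_const_mul,
    integral_rpow_mul_gaussian (by linarith), integral_rpow_mul_gaussian (by linarith)]
  · rw [show (p + 1 - 1) / 2 = p / 2 by ring, show (p + 3 - 1) / 2 = p / 2 + 1 by ring,
      show (p + 1 + 1) / 2 = p / 2 + 1 by ring, show (p + 3 + 1) / 2 = (p / 2 + 1) + 1 by ring,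
      Real.Gamma_add_one (s := p / 2 + 1) (by positivity), Real.rpow_add (by norm_num),
      Real.rpow_one]
    ring
  · exact (integrableOn_rpow_mul_exp_neg_mul_sq (by norm_num) (by linarith)).const_mul 3
  · exact integrableOn_rpow_mul_exp_neg_mul_sq (by norm_num) (by linarith)

theorem integrableOn_cubic_gaussian_mul_rpow {p : ℝ} (hp : 0 < p) :
    IntegrableOn (fun u : ℝ => (3 * u - u ^ 3) * Real.exp (-(1 / 2) * u ^ 2) * u ^ p)
      (Set.Ioi 0) := by
  have e : ∀ u ∈ Set.Ioi (0 : ℝ), 3 * (u ^ (p + 1) * Real.exp (-(1 / 2) * u ^ 2)) -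
        u ^ (p + 3) * Real.exp (-(1 / 2) * u ^ 2) =
      (3 * u - u ^ 3) * Real.exp (-(1 / 2) * u ^ 2) * u ^ p := fun u hu => by
    rw [Real.rpow_add hu, Real.rpow_add hu, Real.rpow_one, show (3 : ℝ) = (3 : ℕ) by norm_num,
      Real.rpow_natCast]
    push_cast; ring
  refine IntegrableOn.congr_fun (Integrable.sub ?_ ?_) e measurableSet_Ioi
  · exact (integrableOn_rpow_mul_exp_neg_mul_sq (by norm_num) (by linarith)).const_mul 3
  · exact integrableOn_rpow_mul_exp_neg_mul_sq (by norm_num) (by linarith)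

theorem integral_cubic_gaussian_mul_integral_sin {Ω : Type*} [MeasurableSpace Ω] (P : Measure Ω)
    [IsProbabilityMeasure P] {Y : Ω → ℝ} (hY : Measurable Y) (s : ℝ) :
    ∫ u in Set.Ioi (0 : ℝ), (3 * u - u ^ 3) * Real.exp (-(1 / 2) * u ^ 2) *
        ∫ ω, Real.sin (s * u * Y ω) ∂P =
      √(2 * Real.pi) / 2 * ∫ ω, (s * Y ω) ^ 3 * Real.exp (-(1 / 2) * (s * Y ω) ^ 2) ∂P := by
  simp_rw [← integral_const_mul]
  rw [integral_integral_swap]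
  · refine integral_congr_ae (.of_forall fun ω => ?_)
    dsimp only
    rw [← integral_Ioi_cubic_gaussian_mul_sin]
    refine integral_congr_ae (.of_forall fun u => ?_)
    dsimp only
    rw [show s * u * Y ω = u * (s * Y ω) by ring]
  · have h := (integrable_cubic_gaussian.integrableOn (s := Set.Ioi 0)).comp_fst P
    exact h.mul_bdd (c := 1) (by fun_prop) (.of_forall fun u => Real.abs_sin_le_one _)

theorem exists_abs_div_rpow_le {S : ℝ → ℝ} {c b α : ℝ} (hα : 1 ≤ α) (hS : ∀ t, |S t| ≤ 1)
    (h : Tendsto (fun t => (S t - c * t) / t ^ α) (𝓝[>] 0) (𝓝 b)) :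
    ∃ C, ∀ t > 0, |(S t - c * t) / t ^ α| ≤ C := by
  have h1 : ∀ᶠ t in 𝓝[>] (0 : ℝ), |(S t - c * t) / t ^ α| < |b| + 1 :=
    h.abs.eventually_lt_const (by linarith)
  obtain ⟨δ, hδ, hb⟩ := mem_nhdsGT_iff_exists_Ioo_subset.1 h1
  have hδ : 0 < δ := hδ
  refine ⟨max (|b| + 1) (1 / δ ^ α + |c| / δ ^ (α - 1)), fun t ht => ?_⟩
  rcases lt_or_ge t δ with h2 | h2
  · exact (hb ⟨ht, h2⟩).le.trans (le_max_left _ _)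
  · refine le_trans ?_ (le_max_right _ _)
    have hta : 0 < t ^ α := Real.rpow_pos_of_pos ht _
    have e1 : |c| * t / t ^ α = |c| / t ^ (α - 1) := by
      rw [Real.rpow_sub_one ht.ne']
      field_simp
    have hp : 0 < δ ^ α := Real.rpow_pos_of_pos hδ _
    have hp' : 0 < δ ^ (α - 1) := Real.rpow_pos_of_pos hδ _
    calc |(S t - c * t) / t ^ α| = |S t - c * t| / t ^ α := by rw [abs_div, abs_of_pos hta]
      _ ≤ (1 + |c| * t) / t ^ α := by
        gcongr
        calc |S t - c * t| ≤ |S t| + |c * t| := abs_sub _ _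
          _ ≤ 1 + |c| * t := by
            rw [abs_mul, abs_of_pos ht]
            linarith [hS t]
      _ = 1 / t ^ α + |c| / t ^ (α - 1) := by rw [add_div, e1]
      _ ≤ _ := by
        have : δ ^ (α - 1) ≤ t ^ (α - 1) := Real.rpow_le_rpow hδ.le h2 (by linarith)
        have : δ ^ α ≤ t ^ α := Real.rpow_le_rpow hδ.le h2 (by linarith)
        gcongr

theorem tendsto_cubic_gaussian_expectation {Ω : Type*} [MeasurableSpace Ω] (P : Measure Ω)
    [IsProbabilityMeasure P] {Y : Ω → ℝ} (hY : Measurable Y) {c b α : ℝ} (hα : 1 ≤ α)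
    (h : Tendsto (fun t => ((∫ ω, Real.sin (t * Y ω) ∂P) - c * t) / t ^ α) (𝓝[>] 0) (𝓝 b)) :
    Tendsto (fun s => s ^ (-α) * ∫ ω, (s * Y ω) ^ 3 * Real.exp (-(1 / 2) * (s * Y ω) ^ 2) ∂P)
      (𝓝[>] 0)
      (𝓝 (2 / √(2 * Real.pi) * (b * ((1 - α) * (2 ^ (α / 2) * Real.Gamma (α / 2 + 1)))))) := by
  set S : ℝ → ℝ := fun t => ∫ ω, Real.sin (t * Y ω) ∂P with hSdef
  have hα0 : 0 < α := by linarith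
  have hS : ∀ t, |S t| ≤ 1 := fun t => by
    have := norm_integral_le_of_norm_le_const (μ := P) (f := fun ω => Real.sin (t * Y ω)) (C := 1)
      (.of_forall fun ω => Real.abs_sin_le_one _)
    simpa using this
  have hSm : StronglyMeasurable S := by
    have : StronglyMeasurable fun p : ℝ × Ω => Real.sin (p.1 * Y p.2) :=
      Measurable.stronglyMeasurable (by fun_prop)
    exact this.integral_prod_right
  obtain ⟨C, hC⟩ := exists_abs_div_rpow_le hα hS h
  set ρ : ℝ → ℝ := fun t => (S t - c * t) / t ^ α with hρ
  set k : ℝ → ℝ := fun u => (3 * u - u ^ 3) * Real.exp (-(1 / 2) * u ^ 2) with hk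
  have hρm : Measurable ρ := by
    have := hSm.measurable
    fun_prop
  have hki : IntegrableOn (fun u => k u * u ^ α) (Set.Ioi 0) :=
    integrableOn_cubic_gaussian_mul_rpow hα0
  have hlim : Tendsto (fun s => ∫ u in Set.Ioi (0 : ℝ), k u * u ^ α * ρ (s * u)) (𝓝[>] 0)
      (𝓝 (∫ u in Set.Ioi (0 : ℝ), k u * u ^ α * b)) := by
    refine tendsto_integral_filter_of_dominated_convergence (fun u => ‖k u * u ^ α‖ * C)
      ?_ ?_ (hki.norm.mul_const C) ?_
    · refine .of_forall fun s => ?_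
      exact hki.aestronglyMeasurable.mul
        (hρm.comp (measurable_const_mul s)).aestronglyMeasurable
    · filter_upwards [self_mem_nhdsWithin] with s hs
      filter_upwards [ae_restrict_mem measurableSet_Ioi] with u hu
      rw [norm_mul]
      exact mul_le_mul_of_nonneg_left (hC _ (mul_pos hs hu)) (norm_nonneg _)
    · filter_upwards [ae_restrict_mem measurableSet_Ioi] with u hu
      refine (h.comp ?_).const_mul _
      refine tendsto_nhdsWithin_iff.2 ⟨?_, ?_⟩
      · have : Tendsto (fun s : ℝ => s * u) (𝓝 0) (𝓝 (0 * u)) := tendsto_id.mul_const u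
        rw [zero_mul] at this
        exact this.mono_left nhdsWithin_le_nhds
      · filter_upwards [self_mem_nhdsWithin] with s hs using mul_pos (Set.mem_Ioi.1 hs) (Set.mem_Ioi.1 hu)
  rw [integral_mul_const, integral_cubic_gaussian_mul_rpow hα0] at hlim
  have hzero : ∫ u in Set.Ioi (0 : ℝ), k u * u = 0 := by
    simpa [k] using integral_cubic_gaussian_mul_rpow (p := 1) one_pos
  have hki1 : IntegrableOn (fun u => k u * u) (Set.Ioi 0) := by
    simpa [k] using integrableOn_cubic_gaussian_mul_rpow (p := 1) one_pos
  have hkS : ∀ s, IntegrableOn (fun u => k u * S (s * u)) (Set.Ioi 0) := fun s =>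
    integrable_cubic_gaussian.integrableOn.mul_bdd (c := 1)
      (hSm.measurable.comp (measurable_const_mul s)).aestronglyMeasurable (.of_forall fun u => hS _)
  have hpi : 0 < √(2 * Real.pi) := by positivity
  refine Tendsto.congr' ?_ (hlim.const_mul (2 / √(2 * Real.pi)) |>.trans (le_of_eq (by ring_nf)))
  filter_upwards [self_mem_nhdsWithin] with s hs
  have hs : 0 < s := hs
  have hE := integral_cubic_gaussian_mul_integral_sin P hY s
  have hsub : ∫ u in Set.Ioi (0 : ℝ), k u * u ^ α * ρ (s * u) =
      ∫ u in Set.Ioi (0 : ℝ), s ^ (-α) * (k u * S (s * u) - c * s * (k u * u)) := by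
    refine setIntegral_congr_fun measurableSet_Ioi fun u hu => ?_
    have hu : 0 < u := hu
    have : 0 < u ^ α := Real.rpow_pos_of_pos hu _
    have : 0 < s ^ α := Real.rpow_pos_of_pos hs _
    simp only [hρ]
    rw [Real.mul_rpow hs.le hu.le, Real.rpow_neg hs.le]
    field_simp
  rw [hsub, integral_const_mul, integral_sub (hkS s) (hki1.const_mul _), integral_const_mul, hzero,
    mul_zero, sub_zero]
  have hE' : ∫ u in Set.Ioi (0 : ℝ), k u * S (s * u) = _ := hE
  rw [hE']
  field_simp

theorem tendsto_integral_comp_of_tendsto_integral_pow {Ω E ι : Type*} [MeasurableSpace Ω]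
    [MeasurableSpace E] {P : Measure Ω} {Q : Measure E} {l : Filter ι}
    {w Z : ι → Ω → ℝ} {w₀ Z₀ : E → ℝ}
    (hw : ∀ᶠ i in l, ∀ᵐ ω ∂P, 0 ≤ w i ω) (hwi : ∀ i, Integrable (w i) P)
    (hZ : ∀ i, Measurable (Z i)) (hZI : ∀ i ω, Z i ω ∈ Set.Icc (0 : ℝ) 1)
    (hw₀ : ∀ᵐ x ∂Q, 0 ≤ w₀ x) (hwi₀ : Integrable w₀ Q)
    (hZ₀ : Measurable Z₀) (hZI₀ : ∀ x, Z₀ x ∈ Set.Icc (0 : ℝ) 1)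
    (hpow : ∀ n : ℕ, Tendsto (fun i => ∫ ω, w i ω * Z i ω ^ n ∂P) l
      (𝓝 (∫ x, w₀ x * Z₀ x ^ n ∂Q)))
    {g : ℝ → ℝ} (hg : Continuous g) :
    Tendsto (fun i => ∫ ω, w i ω * g (Z i ω) ∂P) l (𝓝 (∫ x, w₀ x * g (Z₀ x) ∂Q)) := by
  have hbdd : ∀ f : ℝ → ℝ, Continuous f → ∃ C, ∀ z ∈ Set.Icc (0 : ℝ) 1, ‖f z‖ ≤ C := fun f hf =>
    isCompact_Icc.exists_bound_of_continuousOn hf.continuousOn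
  have hi : ∀ f : ℝ → ℝ, Continuous f → ∀ i, Integrable (fun ω => w i ω * f (Z i ω)) P := by
    intro f hf i
    obtain ⟨C, hC⟩ := hbdd f hf
    exact (hwi i).mul_bdd (hf.measurable.comp (hZ i)).aestronglyMeasurable
      (.of_forall fun ω => hC _ (hZI i ω))
  have hi₀ : ∀ f : ℝ → ℝ, Continuous f → Integrable (fun x => w₀ x * f (Z₀ x)) Q := by
    intro f hf
    obtain ⟨C, hC⟩ := hbdd f hf
    exact hwi₀.mul_bdd (hf.measurable.comp hZ₀).aestronglyMeasurable
      (.of_forall fun x => hC _ (hZI₀ x))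
  have hpoly : ∀ p : Polynomial ℝ, Tendsto (fun i => ∫ ω, w i ω * p.eval (Z i ω) ∂P) l
      (𝓝 (∫ x, w₀ x * p.eval (Z₀ x) ∂Q)) := by
    intro p
    induction p using Polynomial.induction_on' with
    | add p q hp hq =>
      simp only [Polynomial.eval_add, mul_add]
      rw [integral_add (hi₀ _ p.continuous) (hi₀ _ q.continuous)]
      refine (hp.add hq).congr fun i => ?_
      rw [integral_add (hi _ p.continuous i) (hi _ q.continuous i)]
    | monomial n a =>
      simp only [Polynomial.eval_monomial]
      have e : ∀ x y : ℝ, x * (a * y ^ n) = a * (x * y ^ n) := fun x y => by ring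
      simp only [e, integral_const_mul]
      exact (hpow n).const_mul a
  have hmass : Tendsto (fun i => ∫ ω, w i ω ∂P) l (𝓝 (∫ x, w₀ x ∂Q)) := by simpa using hpow 0
  set M := ∫ x, w₀ x ∂Q with hM
  have hM0 : 0 ≤ M := integral_nonneg_of_ae hw₀
  refine Metric.tendsto_nhds.2 fun ε hε => ?_
  set δ := ε / (2 * M + 3) with hδ
  have hδ0 : 0 < δ := by positivity
  obtain ⟨p, hp⟩ := exists_polynomial_near_of_continuousOn 0 1 g hg.continuousOn δ hδ0
  filter_upwards [hw, hmass.eventually_lt_const (lt_add_one M),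
    Metric.tendsto_nhds.1 (hpoly p) δ hδ0] with i h1 h2 h3
  have k1 : |∫ ω, w i ω * p.eval (Z i ω) ∂P - ∫ ω, w i ω * g (Z i ω) ∂P| ≤
      δ * ∫ ω, w i ω ∂P := by
    rw [← integral_sub (hi _ p.continuous i) (hi _ hg i), ← integral_const_mul, ← Real.norm_eq_abs]
    refine norm_integral_le_of_norm_le ((hwi i).const_mul δ) ?_
    filter_upwards [h1] with ω hω
    rw [← mul_sub, norm_mul, Real.norm_of_nonneg hω, mul_comm]
    exact mul_le_mul_of_nonneg_right (hp _ (hZI i ω)).le hω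
  have k2 : |∫ x, w₀ x * p.eval (Z₀ x) ∂Q - ∫ x, w₀ x * g (Z₀ x) ∂Q| ≤ δ * M := by
    rw [← integral_sub (hi₀ _ p.continuous) (hi₀ _ hg), hM, ← integral_const_mul, ← Real.norm_eq_abs]
    refine norm_integral_le_of_norm_le (hwi₀.const_mul δ) ?_
    filter_upwards [hw₀] with x hx
    rw [← mul_sub, norm_mul, Real.norm_of_nonneg hx, mul_comm]
    exact mul_le_mul_of_nonneg_right (hp _ (hZI₀ x)).le hx
  rw [Real.dist_eq] at h3 ⊢
  have hε' : δ * (2 * M + 3) = ε := by rw [hδ]; field_simp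
  have k3 : δ * ∫ ω, w i ω ∂P ≤ δ * (M + 1) := by gcongr
  rw [abs_lt] at h3 ⊢
  rw [abs_le] at k1 k2
  constructor <;> nlinarith

theorem strictAntiOn_gaussian :
    StrictAntiOn (fun x : ℝ => Real.exp (-(1 / 2) * x ^ 2)) (Set.Ici 0) := by
  intro x hx y hy hxy
  have hx : 0 ≤ x := hx
  refine Real.exp_lt_exp.2 ?_
  nlinarith

theorem exists_gaussian_cutoff {p' p q q' : ℝ} (hp' : 0 < p') (hp : p' < p) (hpq : p ≤ q)
    (hq : q < q') :
    ∃ g : ℝ → ℝ, Continuous g ∧ ∀ x : ℝ, 0 ≤ x →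
      0 ≤ x ^ 3 * Real.exp (-(1 / 2) * x ^ 2) * g (Real.exp (-(1 / 2) * x ^ 2)) ∧
      x ^ 3 * Real.exp (-(1 / 2) * x ^ 2) * g (Real.exp (-(1 / 2) * x ^ 2)) ≤ 1 ∧
      (x ∈ Set.Icc p q →
        x ^ 3 * Real.exp (-(1 / 2) * x ^ 2) * g (Real.exp (-(1 / 2) * x ^ 2)) = 1) ∧
      (x ∉ Set.Ioo p' q' →
        x ^ 3 * Real.exp (-(1 / 2) * x ^ 2) * g (Real.exp (-(1 / 2) * x ^ 2)) = 0) := by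
  set e : ℝ → ℝ := fun x => Real.exp (-(1 / 2) * x ^ 2) with he
  have hanti : StrictAntiOn e (Set.Ici 0) := strictAntiOn_gaussian
  have he0 : ∀ x, 0 < e x := fun x => Real.exp_pos _
  have m1 : p' ∈ Set.Ici (0 : ℝ) := hp'.le
  have m2 : p ∈ Set.Ici (0 : ℝ) := (hp'.trans hp).le
  have m3 : q ∈ Set.Ici (0 : ℝ) := ((hp'.trans hp).trans_le hpq).le
  have m4 : q' ∈ Set.Ici (0 : ℝ) := (((hp'.trans hp).trans_le hpq).trans hq).le
  have a1 : e p < e p' := hanti m1 m2 hp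
  have a2 : e q ≤ e p := hanti.antitoneOn m2 m3 hpq
  have a3 : e q' < e q := hanti m3 m4 hq
  have a4 : e p' < 1 := by
    rw [← Real.exp_zero]
    exact Real.exp_lt_exp.2 (by nlinarith)
  have hd : Disjoint (Set.Ioo (e q') (e p'))ᶜ (Set.Icc (e q) (e p)) := by
    rw [Set.disjoint_compl_left_iff_subset]
    exact fun z hz => ⟨a3.trans_le hz.1, hz.2.trans_lt a1⟩
  obtain ⟨κ, κ0, κ1, κI⟩ := exists_continuous_zero_one_of_isClosed
    isOpen_Ioo.isClosed_compl isClosed_Icc hd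
  set cl : ℝ → ℝ := fun z => max (e q') (min (e p') z) with hcl
  have hclI : ∀ z, 0 < cl z ∧ cl z < 1 := fun z =>
    ⟨(he0 _).trans_le (le_max_left _ _),
      max_lt ((a3.trans_le a2).trans (a1.trans a4)) ((min_le_left _ _).trans_lt a4)⟩
  set r : ℝ → ℝ := fun z => (√(-2 * Real.log (cl z)) ^ 3 * cl z)⁻¹ with hr
  have hclc : Continuous cl := by fun_prop
  have hrc : Continuous r := by
    refine Continuous.inv₀ ?_ fun z => ?_
    · have : Continuous fun z => Real.log (cl z) := hclc.log fun z => (hclI z).1.ne'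
      fun_prop
    · have h1 := (hclI z).1
      have h2 : 0 < -2 * Real.log (cl z) := by
        have := Real.log_neg h1 (hclI z).2
        linarith
      positivity
  refine ⟨fun z => κ z * r z, κ.continuous.mul hrc, fun x hx => ?_⟩
  have hval : ∀ x, 0 ≤ x → x ^ 3 * e x * (κ (e x) * r (e x)) = κ (e x) := by
    intro x hx
    by_cases hz : e x ∈ Set.Ioo (e q') (e p')
    · have h1 : cl (e x) = e x := by
        simp only [hcl]
        rw [min_eq_right hz.2.le, max_eq_right hz.1.le]
      have h2 : √(-2 * Real.log (e x)) = x := by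
        simp only [he, Real.log_exp]
        rw [show -2 * (-(1 / 2) * x ^ 2) = x ^ 2 by ring, Real.sqrt_sq hx]
      have hx0 : x ≠ 0 := by
        rintro rfl
        have : e 0 = 1 := by simp [he]
        linarith [hz.2]
      simp only [hr, h1, h2]
      have := he0 x
      field_simp
    · have : κ (e x) = 0 := κ0 hz
      rw [this]
      ring
  change 0 ≤ x ^ 3 * e x * (κ (e x) * r (e x)) ∧ x ^ 3 * e x * (κ (e x) * r (e x)) ≤ 1 ∧
    (_ → x ^ 3 * e x * (κ (e x) * r (e x)) = 1) ∧ (_ → x ^ 3 * e x * (κ (e x) * r (e x)) = 0)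
  rw [hval x hx]
  refine ⟨(κI _).1, (κI _).2, fun h => κ1 ?_, fun h => κ0 fun h' => h ?_⟩
  · exact ⟨hanti.antitoneOn hx m3 h.2, hanti.antitoneOn m2 hx h.1⟩
  · exact ⟨(hanti.lt_iff_gt hx m1).1 h'.2, (hanti.lt_iff_gt m4 hx).1 h'.1⟩

theorem tendsto_rpow_mul_of_tendsto_dyadic {f : ℝ → ℝ} {α a : ℝ} (hα : 1 ≤ α)
    (hf : Tendsto f atTop (𝓝 0))
    (h : Tendsto (fun R => R ^ α * (f R - f (2 * R))) atTop (𝓝 (a * (1 - 2 ^ (-α))))) :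
    (fun R => f R - a * R ^ (-α)) =o[atTop] fun R => R ^ (-α) := by
  set g : ℝ → ℝ := fun R => f R - a * R ^ (-α) with hg
  have hg0 : Tendsto g atTop (𝓝 0) := by
    have := hf.sub ((tendsto_rpow_neg_atTop (zero_lt_one.trans_le hα)).const_mul a)
    simpa using this
  refine isLittleO_iff.2 fun c hc => ?_
  have h1 : ∀ᶠ R in atTop, |R ^ α * (f R - f (2 * R)) - a * (1 - 2 ^ (-α))| < c / 2 :=
    Metric.tendsto_nhds.1 h (c / 2) (by positivity)
  obtain ⟨R₀, hR₀⟩ := eventually_atTop.1 (h1.and (eventually_gt_atTop 0))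
  filter_upwards [eventually_ge_atTop R₀] with R hR
  have hstep : ∀ r ≥ R₀, |g r - g (2 * r)| ≤ c * (r ^ (-α) - (2 * r) ^ (-α)) := by
    intro r hr
    obtain ⟨k1, k2⟩ := hR₀ r hr
    have hp : 0 < r ^ (-α) := Real.rpow_pos_of_pos k2 _
    have hp' : r ^ α * r ^ (-α) = 1 := by rw [← Real.rpow_add k2]; simp
    have h2 : (2 : ℝ) ^ (-α) ≤ 1 / 2 := by
      have := Real.rpow_le_rpow_of_exponent_le (one_le_two (α := ℝ)) (neg_le_neg hα)
      rwa [Real.rpow_neg_one, ← one_div] at this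
    have e1 : g r - g (2 * r) =
        r ^ (-α) * (r ^ α * (f r - f (2 * r)) - a * (1 - 2 ^ (-α))) := by
      simp only [hg]
      rw [Real.mul_rpow zero_le_two k2.le]
      linear_combination (-(f r - f (2 * r))) * hp'
    rw [e1, abs_mul, abs_of_pos hp, Real.mul_rpow zero_le_two k2.le]
    nlinarith [mul_le_mul_of_nonneg_left k1.le hp.le, mul_pos hc hp]
  have hR0 : 0 < R := (hR₀ R hR).2
  have hind : ∀ n : ℕ, |g R - g (2 ^ n * R)| ≤ c * (R ^ (-α) - (2 ^ n * R) ^ (-α)) := by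
    intro n
    induction n with
    | zero => simp
    | succ n ih =>
      have hle : R₀ ≤ 2 ^ n * R := hR.trans (le_mul_of_one_le_left hR0.le (one_le_pow₀ one_le_two))
      have := hstep _ hle
      rw [show (2 : ℝ) ^ (n + 1) * R = 2 * (2 ^ n * R) by ring]
      have t := abs_sub_le (g R) (g (2 ^ n * R)) (g (2 * (2 ^ n * R)))
      linarith
  have hlim : Tendsto (fun n : ℕ => |g R - g (2 ^ n * R)|) atTop (𝓝 |g R - 0|) :=
    ((hg0.comp ((tendsto_pow_atTop_atTop_of_one_lt one_lt_two).atTop_mul_const hR0)).const_sub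
      (g R)).abs
  have hRp : 0 < R ^ (-α) := Real.rpow_pos_of_pos hR0 _
  rw [sub_zero] at hlim
  rw [Real.norm_of_nonneg hRp.le]
  refine le_of_tendsto hlim (.of_forall fun n => (hind n).trans ?_)
  have : 0 < (2 ^ n * R) ^ (-α) := Real.rpow_pos_of_pos (by positivity) _
  gcongr
  linarith

theorem cube_mul_gaussian_le {x : ℝ} : |x ^ 3 * Real.exp (-(1 / 2) * x ^ 2)| ≤ 8 := by
  have h1 := Real.quadratic_le_exp_of_nonneg (x := 1 / 2 * x ^ 2) (by positivity)
  have h2 : Real.exp (-(1 / 2) * x ^ 2) = (Real.exp (1 / 2 * x ^ 2))⁻¹ := by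
    rw [← Real.exp_neg]; ring_nf
  have h3 := Real.exp_pos (1 / 2 * x ^ 2)
  rw [h2, abs_mul, abs_of_pos (inv_pos.2 h3), ← div_eq_mul_inv, div_le_iff₀ h3, abs_le]
  constructor <;> nlinarith [sq_nonneg (x ^ 2 - x), sq_nonneg (x ^ 2 + x), sq_nonneg x]

theorem integrable_cube_mul_gaussian {Ω : Type*} [MeasurableSpace Ω] (P : Measure Ω)
    [IsFiniteMeasure P] {Y : Ω → ℝ} (hY : Measurable Y) (s : ℝ) :
    Integrable (fun ω => (s * Y ω) ^ 3 * Real.exp (-(1 / 2) * (s * Y ω) ^ 2)) P :=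
  Integrable.of_bound (by fun_prop) 8 (.of_forall fun _ => cube_mul_gaussian_le)

theorem tendsto_integral_comp_gaussian {Ω : Type*} [MeasurableSpace Ω] (P : Measure Ω)
    [IsFiniteMeasure P] {Y : Ω → ℝ} (hY : Measurable Y) (hY0 : ∀ ω, 0 ≤ Y ω) {α K : ℝ}
    (hα : α < 3) (hK : 0 ≤ K)
    (h : Tendsto
      (fun s => s ^ (-α) * ∫ ω, (s * Y ω) ^ 3 * Real.exp (-(1 / 2) * (s * Y ω) ^ 2) ∂P)
      (𝓝[>] 0) (𝓝 (K * (2 ^ ((1 - α) / 2) * Real.Gamma ((3 - α) / 2)))))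
    {g : ℝ → ℝ} (hg : Continuous g) :
    Tendsto (fun s => ∫ ω, s ^ (-α) * ((s * Y ω) ^ 3 * Real.exp (-(1 / 2) * (s * Y ω) ^ 2)) *
        g (Real.exp (-(1 / 2) * (s * Y ω) ^ 2)) ∂P) (𝓝[>] 0)
      (𝓝 (∫ x in Set.Ioi (0 : ℝ), K * (x ^ (2 - α) * Real.exp (-(1 / 2) * x ^ 2)) *
        g (Real.exp (-(1 / 2) * x ^ 2)))) := by
  have hI : ∀ x : ℝ, Real.exp (-(1 / 2) * x ^ 2) ∈ Set.Icc (0 : ℝ) 1 := fun x =>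
    ⟨(Real.exp_pos _).le, Real.exp_le_one_iff.2 (by nlinarith [sq_nonneg x])⟩
  refine tendsto_integral_comp_of_tendsto_integral_pow
    (w := fun s ω => s ^ (-α) * ((s * Y ω) ^ 3 * Real.exp (-(1 / 2) * (s * Y ω) ^ 2)))
    (Z := fun s ω => Real.exp (-(1 / 2) * (s * Y ω) ^ 2))
    (w₀ := fun x => K * (x ^ (2 - α) * Real.exp (-(1 / 2) * x ^ 2)))
    (Z₀ := fun x => Real.exp (-(1 / 2) * x ^ 2))
    ?_ (fun s => (integrable_cube_mul_gaussian P hY s).const_mul _) (fun s => by fun_prop)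
    (fun s ω => hI _) ?_ ?_ (by fun_prop) hI ?_ hg
  · filter_upwards [self_mem_nhdsWithin] with s hs
    have hs : 0 < s := hs
    refine .of_forall fun ω => ?_
    have := hY0 ω
    positivity
  · filter_upwards [ae_restrict_mem measurableSet_Ioi] with x hx
    have hx : 0 < x := hx
    positivity
  · exact (integrableOn_rpow_mul_exp_neg_mul_sq (by norm_num) (by linarith)).const_mul K
  · intro n
    set t : ℝ := √(n + 1) with ht
    have hn : (0 : ℝ) < n + 1 := by positivity
    have ht0 : 0 < t := Real.sqrt_pos.2 hn
    have ht2 : t ^ 2 = n + 1 := Real.sq_sqrt hn.le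
    have hexp : ∀ x : ℝ, Real.exp (-(1 / 2) * x ^ 2) * Real.exp (-(1 / 2) * x ^ 2) ^ n =
        Real.exp (-(1 / 2) * (t * x) ^ 2) := fun x => by
      rw [← Real.exp_nat_mul, ← Real.exp_add, mul_pow, ht2]
      ring_nf
    have hst : Tendsto (fun s : ℝ => t * s) (𝓝[>] 0) (𝓝[>] 0) := by
      refine tendsto_nhdsWithin_iff.2 ⟨?_, ?_⟩
      · have : Tendsto (fun s : ℝ => t * s) (𝓝 0) (𝓝 (t * 0)) := tendsto_id.const_mul t
        rw [mul_zero] at this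
        exact this.mono_left nhdsWithin_le_nhds
      · filter_upwards [self_mem_nhdsWithin] with s hs using mul_pos ht0 (Set.mem_Ioi.1 hs)
    have hlim := (h.comp hst).const_mul (t ^ (α - 3))
    have hR : ∫ x in Set.Ioi (0 : ℝ), K * (x ^ (2 - α) * Real.exp (-(1 / 2) * x ^ 2)) *
        Real.exp (-(1 / 2) * x ^ 2) ^ n =
        t ^ (α - 3) * (K * (2 ^ ((1 - α) / 2) * Real.Gamma ((3 - α) / 2))) := by
      have e1 : ∀ x ∈ Set.Ioi (0 : ℝ), K * (x ^ (2 - α) * Real.exp (-(1 / 2) * x ^ 2)) *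
          Real.exp (-(1 / 2) * x ^ 2) ^ n =
          (K * t ^ (α - 2)) * ((t * x) ^ (2 - α) * Real.exp (-(1 / 2) * (t * x) ^ 2)) := by
        intro x hx
        rw [← hexp, Real.mul_rpow ht0.le (Set.mem_Ioi.1 hx).le]
        have : t ^ (α - 2) * t ^ (2 - α) = 1 := by rw [← Real.rpow_add ht0]; simp
        linear_combination (-(K * x ^ (2 - α) * Real.exp (-(1 / 2) * x ^ 2) *
          Real.exp (-(1 / 2) * x ^ 2) ^ n)) * this
      rw [setIntegral_congr_fun measurableSet_Ioi e1, integral_const_mul,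
        integral_comp_mul_left_Ioi (fun y => y ^ (2 - α) * Real.exp (-(1 / 2) * y ^ 2)) 0 ht0,
        mul_zero, integral_rpow_mul_gaussian (by linarith), smul_eq_mul,
        show α - 2 = (α - 3) + 1 by ring, Real.rpow_add ht0, Real.rpow_one,
        show (2 - α - 1) / 2 = (1 - α) / 2 by ring, show (2 - α + 1) / 2 = (3 - α) / 2 by ring]
      field_simp
    rw [hR]
    refine hlim.congr' ?_
    filter_upwards [self_mem_nhdsWithin] with s hs
    have hs : 0 < s := hs
    simp only [Function.comp]
    rw [← integral_const_mul, ← integral_const_mul]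
    refine integral_congr_ae (.of_forall fun ω => ?_)
    dsimp only
    rw [mul_assoc t, ← hexp, Real.mul_rpow ht0.le hs.le]
    have : t ^ (α - 3) * t ^ (-α) * t ^ 3 = 1 := by
      rw [← Real.rpow_add ht0, ← Real.rpow_natCast, ← Real.rpow_add ht0,
        show α - 3 + -α + ((3 : ℕ) : ℝ) = 0 by push_cast; ring, Real.rpow_zero]
    linear_combination (s ^ (-α) * (s * Y ω) ^ 3 * Real.exp (-(1 / 2) * (s * Y ω) ^ 2) *
          Real.exp (-(1 / 2) * (s * Y ω) ^ 2) ^ n) * this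

theorem integral_Ioc_rpow_neg {p q K α : ℝ} (hα : 0 < α) (hp : 0 < p) (hpq : p ≤ q) :
    ∫ x in Set.Ioc p q, K * x ^ (-1 - α) = K / α * (p ^ (-α) - q ^ (-α)) := by
  rw [integral_const_mul, ← intervalIntegral.integral_of_le hpq, integral_rpow]
  · rw [show -1 - α + 1 = -α by ring]
    field_simp
    ring
  · right
    refine ⟨by linarith, ?_⟩
    rw [Set.uIcc_of_le hpq]
    exact fun h => absurd h.1 (not_le.2 hp)

theorem integrableOn_Ioc_rpow_neg {p q K α : ℝ} (hp : 0 < p) :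
    IntegrableOn (fun x => K * x ^ (-1 - α)) (Set.Ioc p q) := by
  refine IntegrableOn.mono_set (ContinuousOn.integrableOn_Icc fun x hx => ?_) Set.Ioc_subset_Icc_self
  have : x ≠ 0 := (hp.trans_le hx.1).ne'
  exact ((Real.continuousAt_rpow_const x _ (.inl this)).const_mul K).continuousWithinAt

theorem tendsto_rpow_mul_measureReal_Ioc {Ω : Type*} [MeasurableSpace Ω] (P : Measure Ω)
    [IsFiniteMeasure P] {Y : Ω → ℝ} (hY : Measurable Y) (hY0 : ∀ ω, 0 ≤ Y ω) {α K p q : ℝ}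
    (hα0 : 0 < α) (hα : α < 3) (hK : 0 ≤ K) (hp : 0 < p) (hpq : p < q)
    (h : Tendsto
      (fun s => s ^ (-α) * ∫ ω, (s * Y ω) ^ 3 * Real.exp (-(1 / 2) * (s * Y ω) ^ 2) ∂P)
      (𝓝[>] 0) (𝓝 (K * (2 ^ ((1 - α) / 2) * Real.Gamma ((3 - α) / 2))))) :
    Tendsto (fun s => s ^ (-α) * P.real {ω | s * Y ω ∈ Set.Ioc p q}) (𝓝[>] 0)
      (𝓝 (K / α * (p ^ (-α) - q ^ (-α)))) := by
  have hq : 0 < q := hp.trans hpq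
  have hcont : ∀ x : ℝ, 0 < x → ∀ c : ℝ, Tendsto (fun δ : ℝ => (x + c * δ) ^ (-α)) (𝓝[>] 0)
      (𝓝 (x ^ (-α))) := fun x hx c => by
    have h1 : Tendsto (fun δ : ℝ => x + c * δ) (𝓝 0) (𝓝 (x + c * 0)) :=
      (tendsto_id.const_mul c).const_add x
    rw [mul_zero, add_zero] at h1
    exact (h1.rpow_const (.inl hx.ne')).mono_left nhdsWithin_le_nhds
  have hsmall : ∀ᶠ δ : ℝ in 𝓝[>] 0, 0 < δ ∧ δ < p / 2 ∧ δ < (q - p) / 2 := by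
    have : Set.Ioo 0 (min (p / 2) ((q - p) / 2)) ∈ 𝓝[>] (0 : ℝ) :=
      Ioo_mem_nhdsGT (lt_min (by linarith) (by linarith))
    filter_upwards [this] with δ hδ
    exact ⟨hδ.1, hδ.2.trans_le (min_le_left _ _), hδ.2.trans_le (min_le_right _ _)⟩
  have hset : ∀ s, MeasurableSet {ω | s * Y ω ∈ Set.Ioc p q} := fun s =>
    (hY.const_mul s) measurableSet_Ioc
  have hind : ∀ s, s ^ (-α) * P.real {ω | s * Y ω ∈ Set.Ioc p q} =
      ∫ ω, ({ω | s * Y ω ∈ Set.Ioc p q}).indicator (fun _ => s ^ (-α)) ω ∂P := fun s => by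
    rw [integral_indicator (hset s), setIntegral_const, smul_eq_mul, mul_comm]
  have hindi : ∀ s, Integrable
      (({ω | s * Y ω ∈ Set.Ioc p q}).indicator (fun _ => s ^ (-α))) P := fun s =>
    (integrable_const _).indicator (hset s)
  have hgi : ∀ g : ℝ → ℝ, Continuous g → ∀ s, Integrable (fun ω => s ^ (-α) * ((s * Y ω) ^ 3 *
      Real.exp (-(1 / 2) * (s * Y ω) ^ 2)) * g (Real.exp (-(1 / 2) * (s * Y ω) ^ 2))) P := by
    intro g hg s
    obtain ⟨C, hC⟩ := isCompact_Icc.exists_bound_of_continuousOn (hg.continuousOn (s := Set.Icc 0 1))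
    refine ((integrable_cube_mul_gaussian P hY s).const_mul _).mul_bdd (c := C) ?_
      (.of_forall fun ω => hC _ ⟨(Real.exp_pos _).le,
        Real.exp_le_one_iff.2 (by nlinarith [sq_nonneg (s * Y ω)])⟩)
    exact (hg.measurable.comp (by fun_prop)).aestronglyMeasurable
  have hgi₀ : ∀ g : ℝ → ℝ, Continuous g → IntegrableOn (fun x => K * (x ^ (2 - α) *
      Real.exp (-(1 / 2) * x ^ 2)) * g (Real.exp (-(1 / 2) * x ^ 2))) (Set.Ioi 0) := by
    intro g hg
    obtain ⟨C, hC⟩ := isCompact_Icc.exists_bound_of_continuousOn (hg.continuousOn (s := Set.Icc 0 1))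
    refine ((integrableOn_rpow_mul_exp_neg_mul_sq (by norm_num) (by linarith)).const_mul K).mul_bdd
      (c := C) ?_ (.of_forall fun x => hC _ ⟨(Real.exp_pos _).le,
        Real.exp_le_one_iff.2 (by nlinarith [sq_nonneg x])⟩)
    exact (hg.measurable.comp (by fun_prop)).aestronglyMeasurable
  have hform : ∀ g : ℝ → ℝ, ∀ x : ℝ, 0 < x → K * (x ^ (2 - α) * Real.exp (-(1 / 2) * x ^ 2)) *
      g (Real.exp (-(1 / 2) * x ^ 2)) = K * x ^ (-1 - α) *
      (x ^ 3 * Real.exp (-(1 / 2) * x ^ 2) * g (Real.exp (-(1 / 2) * x ^ 2))) := by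
    intro g x hx
    have : x ^ (2 - α) = x ^ (-1 - α) * x ^ 3 := by
      rw [← Real.rpow_natCast, ← Real.rpow_add hx]
      norm_num
      ring_nf
    rw [this]
    ring
  have hpos : ∀ x : ℝ, 0 < x → 0 ≤ K * x ^ (-1 - α) := fun x hx => by positivity
  refine tendsto_order.2 ⟨fun L hL => ?_, fun L hL => ?_⟩
  · have hl := (((hcont p hp 1).sub (hcont q hq (-1))).const_mul (K / α)).eventually_const_lt hL
    obtain ⟨δ, hδ, hδ0, hδp, hδq⟩ := (hl.and hsmall).exists
    obtain ⟨g, hg, hgx⟩ := exists_gaussian_cutoff hp (lt_add_of_pos_right p hδ0)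
      (by linarith : p + δ ≤ q - δ) (sub_lt_self q hδ0)
    have hlim := tendsto_integral_comp_gaussian P hY hY0 hα hK h hg
    have hlow : K / α * ((p + δ) ^ (-α) - (q - δ) ^ (-α)) ≤
        ∫ x in Set.Ioi (0 : ℝ), K * (x ^ (2 - α) * Real.exp (-(1 / 2) * x ^ 2)) *
        g (Real.exp (-(1 / 2) * x ^ 2)) := by
      rw [← integral_Ioc_rpow_neg hα0 (by linarith) (by linarith)]
      have hsub : Set.Ioc (p + δ) (q - δ) ⊆ Set.Ioi 0 := fun x hx => by
        have := hx.1
        simp only [Set.mem_Ioi]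
        linarith
      refine le_trans (le_of_eq ?_) (setIntegral_mono_set (hgi₀ g hg) ?_ hsub.eventuallyLE)
      · refine setIntegral_congr_fun measurableSet_Ioc fun x hx => ?_
        have hx0 : 0 < x := hsub hx
        rw [hform g x hx0, (hgx x hx0.le).2.2.1 ⟨hx.1.le, hx.2⟩, mul_one]
      · filter_upwards [ae_restrict_mem measurableSet_Ioi] with x hx
        rw [hform g x hx]
        exact mul_nonneg (hpos x hx) (hgx x (le_of_lt hx)).1
    have hL' : L < K / α * ((p + δ) ^ (-α) - (q - δ) ^ (-α)) := by
      rw [show p + δ = p + 1 * δ by ring, show q - δ = q + -1 * δ by ring]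
      exact hδ
    filter_upwards [hlim.eventually_const_lt (hL'.trans_le hlow), self_mem_nhdsWithin] with s h1 hs
    have hs : 0 < s := hs
    refine h1.trans_le ?_
    rw [hind]
    refine integral_mono (hgi g hg s) (hindi s) fun ω => ?_
    have hw := hgx (s * Y ω) (mul_nonneg hs.le (hY0 ω))
    have hsp : 0 < s ^ (-α) := Real.rpow_pos_of_pos hs _
    dsimp only
    rw [mul_assoc]
    by_cases hm : s * Y ω ∈ Set.Ioc p q
    · rw [Set.indicator_of_mem (by exact hm)]
      exact mul_le_of_le_one_right hsp.le hw.2.1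
    · rw [Set.indicator_of_notMem (by exact hm), hw.2.2.2 fun hm' => hm ⟨hm'.1, hm'.2.le⟩, mul_zero]
  · have hl := (((hcont p hp (-1)).sub (hcont q hq 1)).const_mul (K / α)).eventually_lt_const hL
    obtain ⟨δ, hδ, hδ0, hδp, hδq⟩ := (hl.and hsmall).exists
    obtain ⟨g, hg, hgx⟩ := exists_gaussian_cutoff (by linarith : 0 < p - δ) (sub_lt_self p hδ0)
      hpq.le (lt_add_of_pos_right q hδ0)
    have hlim := tendsto_integral_comp_gaussian P hY hY0 hα hK h hg
    have hup : ∫ x in Set.Ioi (0 : ℝ), K * (x ^ (2 - α) * Real.exp (-(1 / 2) * x ^ 2)) *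
        g (Real.exp (-(1 / 2) * x ^ 2)) ≤ K / α * ((p - δ) ^ (-α) - (q + δ) ^ (-α)) := by
      rw [← integral_Ioc_rpow_neg hα0 (by linarith) (by linarith),
        ← integral_indicator measurableSet_Ioi, ← integral_indicator measurableSet_Ioc]
      refine integral_mono ((integrable_indicator_iff measurableSet_Ioi).2 (hgi₀ g hg))
        ((integrable_indicator_iff measurableSet_Ioc).2
          (integrableOn_Ioc_rpow_neg (by linarith))) fun x => ?_
      by_cases hx : x ∈ Set.Ioi (0 : ℝ)
      · rw [Set.indicator_of_mem hx, hform g x hx]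
        by_cases hm : x ∈ Set.Ioc (p - δ) (q + δ)
        · rw [Set.indicator_of_mem hm]
          exact mul_le_of_le_one_right (hpos x hx) (hgx x (le_of_lt hx)).2.1
        · rw [Set.indicator_of_notMem hm,
            (hgx x (le_of_lt hx)).2.2.2 fun hm' => hm ⟨hm'.1, hm'.2.le⟩, mul_zero]
      · rw [Set.indicator_of_notMem hx, Set.indicator_of_notMem]
        refine fun hm => hx ?_
        have := hm.1
        simp only [Set.mem_Ioi]
        linarith
    have hL' : K / α * ((p - δ) ^ (-α) - (q + δ) ^ (-α)) < L := by
      rw [show p - δ = p + -1 * δ by ring, show q + δ = q + 1 * δ by ring]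
      exact hδ
    filter_upwards [hlim.eventually_lt_const (hup.trans_lt hL'), self_mem_nhdsWithin] with s h1 hs
    have hs : 0 < s := hs
    refine lt_of_le_of_lt ?_ h1
    rw [hind]
    refine integral_mono (hindi s) (hgi g hg s) fun ω => ?_
    have hw := hgx (s * Y ω) (mul_nonneg hs.le (hY0 ω))
    have hsp : 0 < s ^ (-α) := Real.rpow_pos_of_pos hs _
    dsimp only
    rw [mul_assoc]
    by_cases hm : s * Y ω ∈ Set.Ioc p q
    · rw [Set.indicator_of_mem (by exact hm), hw.2.2.1 ⟨hm.1.le, hm.2⟩, mul_one]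
    · rw [Set.indicator_of_notMem (by exact hm)]
      exact mul_nonneg hsp.le hw.1

theorem isLittleO_tail_of_tendsto_cubic_gaussian {Ω : Type*} [MeasurableSpace Ω] (P : Measure Ω)
    [IsFiniteMeasure P] {Y : Ω → ℝ} (hY : Measurable Y) (hY0 : ∀ ω, 0 ≤ Y ω) {α K : ℝ}
    (hα1 : 1 ≤ α) (hα : α < 3) (hK : 0 ≤ K)
    (h : Tendsto
      (fun s => s ^ (-α) * ∫ ω, (s * Y ω) ^ 3 * Real.exp (-(1 / 2) * (s * Y ω) ^ 2) ∂P)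
      (𝓝[>] 0) (𝓝 (K * (2 ^ ((1 - α) / 2) * Real.Gamma ((3 - α) / 2))))) :
    (fun R : ℝ => P.real {ω | R < Y ω} - K / α * R ^ (-α)) =o[atTop] fun R : ℝ => R ^ (-α) := by
  refine tendsto_rpow_mul_of_tendsto_dyadic hα1 ?_ ?_
  · have h1 : Tendsto (fun R : ℝ => P {ω | R < Y ω}) atTop (𝓝 (P (⋂ R : ℝ, {ω | R < Y ω}))) := by
      refine tendsto_measure_iInter_atTop (fun R => (hY measurableSet_Ioi).nullMeasurableSet) ?_
        ⟨0, measure_ne_top _ _⟩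
      exact fun a b hab ω hω => lt_of_le_of_lt hab hω
    have h2 : (⋂ R : ℝ, {ω | R < Y ω}) = ∅ := by
      ext ω
      simp only [Set.mem_iInter, Set.mem_ofPred_eq, Set.mem_empty_iff_false, iff_false, not_forall]
      exact ⟨Y ω, lt_irrefl _⟩
    rw [h2, measure_empty] at h1
    exact (ENNReal.tendsto_toReal ENNReal.zero_ne_top).comp h1
  · have h1 := (tendsto_rpow_mul_measureReal_Ioc P hY hY0 (by linarith) hα hK one_pos one_lt_two
      h).comp tendsto_inv_atTop_nhdsGT_zero
    rw [Real.one_rpow] at h1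
    refine h1.congr' ?_
    filter_upwards [eventually_gt_atTop 0] with R hR
    have hs : {ω | R⁻¹ * Y ω ∈ Set.Ioc (1 : ℝ) 2} = {ω | R < Y ω} \ {ω | 2 * R < Y ω} := by
      ext ω
      simp only [Set.mem_Ioc, Set.mem_ofPred_eq, Set.mem_sdiff, not_lt, inv_mul_eq_div,
        one_lt_div hR, div_le_iff₀ hR]
    have hss : {ω | 2 * R < Y ω} ⊆ {ω | R < Y ω} := fun ω hω => by
      have : 2 * R < Y ω := hω
      change R < Y ω
      linarith
    simp only [Function.comp]
    rw [hs, measureReal_sdiff hss (hY measurableSet_Ioi), Real.inv_rpow hR.le, Real.rpow_neg hR.le,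
      inv_inv]

theorem cubic_gaussian_constant_eq {ν b : ℝ} (hν0 : 0 < ν) (hν1 : ν < 1) :
    2 / √(2 * Real.pi) * (b * ((1 - (1 + ν)) * (2 ^ ((1 + ν) / 2) *
        Real.Gamma ((1 + ν) / 2 + 1)))) =
      ((1 + ν) * (-(ν * b / Real.Gamma (1 - ν)) * (Real.cos (Real.pi * ν / 2))⁻¹)) *
        (2 ^ ((1 - (1 + ν)) / 2) * Real.Gamma ((3 - (1 + ν)) / 2)) := by
  have hcos : 0 < Real.cos (Real.pi * ν / 2) :=
    Real.cos_pos_of_mem_Ioo ⟨by nlinarith [Real.pi_pos], by nlinarith [Real.pi_pos]⟩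
  have hG : 0 < Real.Gamma (1 - ν) := Real.Gamma_pos_of_pos (by linarith)
  have hH : 0 < Real.Gamma ((1 - ν) / 2) := Real.Gamma_pos_of_pos (by linarith)
  have hpi : 0 < √Real.pi := Real.sqrt_pos.2 Real.pi_pos
  have hdup := Real.Gamma_mul_Gamma_add_half ((1 - ν) / 2)
  have hrefl := Real.Gamma_mul_Gamma_one_sub ((1 - ν) / 2)
  rw [show (1 - ν) / 2 + 1 / 2 = 1 - ν / 2 by ring, show 2 * ((1 - ν) / 2) = 1 - ν by ring,
    show 1 - (1 - ν) = ν by ring] at hdup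
  rw [show 1 - (1 - ν) / 2 = (1 + ν) / 2 by ring,
    show Real.pi * ((1 - ν) / 2) = Real.pi / 2 - Real.pi * ν / 2 by ring,
    Real.sin_pi_div_two_sub] at hrefl
  rw [Real.Gamma_add_one (by positivity), show (3 - (1 + ν)) / 2 = 1 - ν / 2 by ring,
    Real.sqrt_mul zero_le_two, show (1 + ν) / 2 = ν / 2 + 1 / 2 by ring,
    Real.rpow_add zero_lt_two, ← Real.sqrt_eq_rpow, show ν / 2 + 1 / 2 = (1 + ν) / 2 by ring,
    eq_div_of_mul_eq hH.ne' ((mul_comm _ _).trans hdup),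
    eq_div_of_mul_eq hH.ne' ((mul_comm _ _).trans hrefl)]
  have e1 : (2 : ℝ) ^ ν = 2 ^ (ν / 2) * 2 ^ (ν / 2) := by
    rw [← Real.rpow_add zero_lt_two]; ring_nf
  have e2 : (2 : ℝ) ^ ((1 - (1 + ν)) / 2) * 2 ^ (ν / 2) = 1 := by
    rw [← Real.rpow_add zero_lt_two]; ring_nf; simp
  have e3 : √Real.pi * √Real.pi = Real.pi := Real.mul_self_sqrt Real.pi_pos.le
  have e4 : (2 : ℝ) ^ ((1 - (1 + ν)) / 2) * 2 ^ ν = 2 ^ (ν / 2) := by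
    rw [e1, ← mul_assoc, e2, one_mul]
  have h2 : (0 : ℝ) < √2 := by positivity
  calc _ = -(b * ν * (1 + ν) * 2 ^ (ν / 2) * (Real.pi / √Real.pi) /
        (Real.cos (Real.pi * ν / 2) * Real.Gamma ((1 - ν) / 2))) := by
        field_simp
        ring
    _ = -(b * ν * (1 + ν) * (2 ^ ((1 - (1 + ν)) / 2) * 2 ^ ν) * √Real.pi /
        (Real.cos (Real.pi * ν / 2) * Real.Gamma ((1 - ν) / 2))) := by
        rw [e4, Real.div_sqrt]
    _ = _ := by
        field_simp

theorem tendsto_integral_sin_sub_div_rpow {Ω : Type*} [MeasurableSpace Ω] (P : Measure Ω)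
    [IsProbabilityMeasure P] {Y : Ω → ℝ} (hY : Measurable Y) {c α : ℝ} {c₂ : ℂ}
    (h : (fun t : ℝ => (∫ ω, cexp (I * (t : ℂ) * (Y ω : ℂ)) ∂P) -
        (1 + I * (c : ℂ) * (t : ℂ) +
          (if 0 < t then c₂ else starRingEnd ℂ c₂) * ((|t| ^ α : ℝ) : ℂ)))
        =o[𝓝[≠] (0 : ℝ)] fun t : ℝ => |t| ^ α) :
    Tendsto (fun t => ((∫ ω, Real.sin (t * Y ω) ∂P) - c * t) / t ^ α) (𝓝[>] 0) (𝓝 c₂.im) := by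
  have him : ∀ t : ℝ, (∫ ω, cexp (I * (t : ℂ) * (Y ω : ℂ)) ∂P).im =
      ∫ ω, Real.sin (t * Y ω) ∂P := by
    intro t
    have e : ∀ ω, cexp (I * (t : ℂ) * (Y ω : ℂ)) = cexp (((t * Y ω : ℝ) : ℂ) * I) := fun ω => by
      push_cast
      ring_nf
    have hint : Integrable (fun ω => cexp (I * (t : ℂ) * (Y ω : ℂ))) P := by
      refine Integrable.of_bound (by fun_prop) 1 (.of_forall fun ω => ?_)
      rw [e, norm_exp_ofReal_mul_I]
    have h5 := imCLM.integral_comp_comm hint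
    simp only [imCLM_apply] at h5
    rw [← h5]
    refine integral_congr_ae (.of_forall fun ω => ?_)
    dsimp only
    rw [e, exp_ofReal_mul_I_im]
  have h1 := h.mono (nhdsWithin_mono (0 : ℝ) fun t (ht : 0 < t) => ht.ne')
  have h2 : (fun t : ℝ => (∫ ω, Real.sin (t * Y ω) ∂P) - c * t - c₂.im * t ^ α)
      =o[𝓝[>] (0 : ℝ)] fun t : ℝ => t ^ α := by
    refine IsBigO.trans_isLittleO (IsBigO.of_bound 1 ?_) (h1.congr' EventuallyEq.rfl ?_)
    · filter_upwards [self_mem_nhdsWithin] with t ht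
      have ht : 0 < t := ht
      rw [one_mul]
      refine le_trans (le_of_eq ?_) (abs_im_le_norm _)
      rw [if_pos ht, abs_of_pos ht, sub_im, him, Real.norm_eq_abs]
      congr 1
      simp
      ring
    · filter_upwards [self_mem_nhdsWithin] with t ht
      rw [abs_of_pos (Set.mem_Ioi.1 ht)]
  have h3 := h2.tendsto_div_nhds_zero.add_const c₂.im
  rw [zero_add] at h3
  refine h3.congr' ?_
  filter_upwards [self_mem_nhdsWithin] with t ht
  have : 0 < t ^ α := Real.rpow_pos_of_pos ht _
  field_simp
  ring

/-- **Tauberian theorem, order `1 + ν` with `ν ∈ (0,1)`.**  Let `X` be a non-negative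
integer-valued random variable with characteristic function `φ(t) = 𝔼[e^{itX}]`.  If
`φ(t) = 1 + i c₁ t + (c₂ 1_{t>0} + c̄₂ 1_{t<0}) |t|^{1+ν} + o(|t|^{1+ν})` as `t → 0`
for some `c₁ > 0`, `c₂` with `Im c₂ ≠ 0`, and `ν ∈ (0,1)`, then necessarily
`Im c₂ < 0`, and with `a = -(ν Im c₂ / Γ(1-ν)) sec(πν/2) > 0` one has
`ℙ[X > R] = a R^{-ν-1} + o(R^{-ν-1})` as `R → ∞`. -/
theorem stmt_15
    {Ω : Type*} [MeasurableSpace Ω] (P : Measure Ω) [IsProbabilityMeasure P]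
    (X : Ω → ℕ) (hX : Measurable X)
    (φ : ℝ → ℂ)
    (hφ : ∀ t : ℝ, φ t = ∫ ω, Complex.exp (Complex.I * (t : ℂ) * (X ω : ℂ)) ∂P)
    (c₁ : ℝ) (hc₁ : 0 < c₁)
    (c₂ : ℂ) (hc₂ : c₂.im ≠ 0)
    (ν : ℝ) (hν0 : 0 < ν) (hν1 : ν < 1)
    (hasymp : (fun t : ℝ => φ t -
        (1 + Complex.I * (c₁ : ℂ) * (t : ℂ) +
          (if 0 < t then c₂ else starRingEnd ℂ c₂) * ((|t| ^ (1 + ν) : ℝ) : ℂ)))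
        =o[𝓝[≠] (0 : ℝ)] fun t : ℝ => |t| ^ (1 + ν))
    (a : ℝ)
    (ha : a = -(ν * c₂.im / Real.Gamma (1 - ν)) * (Real.cos (Real.pi * ν / 2))⁻¹) :
    c₂.im < 0 ∧ 0 < a ∧
      (fun R : ℝ => (P {ω | R < (X ω : ℝ)}).toReal - a * R ^ (-ν - 1))
        =o[atTop] fun R : ℝ => R ^ (-ν - 1) := by
  have hY : Measurable fun ω => (X ω : ℝ) := measurable_from_top.comp hX
  have hY0 : ∀ ω, (0 : ℝ) ≤ X ω := fun ω => Nat.cast_nonneg _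
  have hsin := tendsto_integral_sin_sub_div_rpow P hY (c := c₁) (α := 1 + ν) (c₂ := c₂)
    (by simpa [hφ] using hasymp)
  have hlim := tendsto_cubic_gaussian_expectation P hY (by linarith) hsin
  have hcos : 0 < Real.cos (Real.pi * ν / 2) :=
    Real.cos_pos_of_mem_Ioo ⟨by nlinarith [Real.pi_pos], by nlinarith [Real.pi_pos]⟩
  have hG : 0 < Real.Gamma (1 - ν) := Real.Gamma_pos_of_pos (by linarith)
  have hG' : 0 < Real.Gamma ((3 - (1 + ν)) / 2) := Real.Gamma_pos_of_pos (by linarith)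
  rw [cubic_gaussian_constant_eq hν0 hν1, ← ha] at hlim
  have hnonneg : 0 ≤ (1 + ν) * a * (2 ^ ((1 - (1 + ν)) / 2) * Real.Gamma ((3 - (1 + ν)) / 2)) := by
    refine ge_of_tendsto hlim ?_
    filter_upwards [self_mem_nhdsWithin] with s hs
    have hs : 0 < s := hs
    refine mul_nonneg (by positivity) (integral_nonneg fun ω => ?_)
    positivity
  have ha0 : 0 ≤ a := by
    have := nonneg_of_mul_nonneg_left hnonneg (by positivity)
    exact nonneg_of_mul_nonneg_right this (by linarith)
  have ha' : a * (Real.Gamma (1 - ν) * Real.cos (Real.pi * ν / 2)) = -(ν * c₂.im) := by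
    have hc := hcos.ne'
    have hg := hG.ne'
    rw [ha]
    generalize Real.cos (Real.pi * ν / 2) = C at hc ⊢
    field_simp
  have him : c₂.im < 0 := by
    refine lt_of_le_of_ne ?_ hc₂
    have : 0 ≤ -(ν * c₂.im) := ha' ▸ by positivity
    nlinarith
  refine ⟨him, ?_, ?_⟩
  · refine lt_of_le_of_ne ha0 fun h => ?_
    rw [← h, zero_mul] at ha'
    nlinarith
  · have hK : 0 ≤ (1 + ν) * a := by positivity
    have := isLittleO_tail_of_tendsto_cubic_gaussian P hY hY0 (by linarith) (by linarith) hK hlim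
    rw [mul_div_cancel_left₀ a (by linarith : 1 + ν ≠ 0), show -(1 + ν) = -ν - 1 by ring] at this
    exact this
end

section
/- Let ψ be a complex-valued function on the closed unit disk 𝔻̄ = {z ∈ ℂ : |z| ≤ 1} that is holomorphic on the open disk 𝔻 and continuous on 𝔻̄. Suppose there exist ν ∈ (0,1) and c ∈ ℂ with Re(c) ≠ 0 such that ψ(e^{it}) = 1 + (c·𝟙_{t>0} + c̄·𝟙_{t<0})·|t|^ν + o(|t|^ν) as t → 0. Then, setting b = Re(c)·sec(πν/2) ∈ ℝ \ {0}, one has ψ(1 − r) = 1 + b·r^ν + o(r^ν) as r ↓ 0. -/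
open Complex Asymptotics Filter Topology

/-- On the closed right half-plane, `Re (w ^ ν)` dominates `cos (πν/2) ‖w‖ ^ ν`. -/
lemma cos_mul_norm_rpow_le_re_cpow {ν : ℝ} (hν0 : 0 ≤ ν) (hν1 : ν ≤ 1) {w : ℂ} (hw : 0 ≤ w.re) :
    Real.cos (Real.pi * ν / 2) * ‖w‖ ^ ν ≤ (w ^ (ν : ℂ)).re := by
  rw [Complex.cpow_ofReal_re, mul_comm]
  gcongr
  have h := Complex.abs_arg_le_pi_div_two_iff.2 hw
  rw [← Real.cos_abs (w.arg * ν)]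
  apply Real.cos_le_cos_of_nonneg_of_le_pi (abs_nonneg _)
  · nlinarith [Real.pi_pos]
  · rw [abs_mul, abs_of_nonneg hν0]
    nlinarith

lemma cos_pi_mul_div_two_pos {ν : ℝ} (hν0 : 0 ≤ ν) (hν1 : ν < 1) :
    0 < Real.cos (Real.pi * ν / 2) :=
  Real.cos_pos_of_mem_Ioo ⟨by nlinarith [Real.pi_pos], by nlinarith [Real.pi_pos]⟩

/-- Maximum principle for the real part of a holomorphic function. -/
lemma re_nonpos_of_re_nonpos_on_sphere {F : ℂ → ℂ} (hF : DiffContOnCl ℂ F (Metric.ball 0 1))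
    (h : ∀ z : ℂ, ‖z‖ = 1 → (F z).re ≤ 0) {z : ℂ} (hz : ‖z‖ ≤ 1) : (F z).re ≤ 0 := by
  have hE : DiffContOnCl ℂ (fun z => Complex.exp (F z)) (Metric.ball 0 1) :=
    Complex.differentiable_exp.comp_diffContOnCl hF
  have key := Complex.norm_le_of_forall_mem_frontier_norm_le (C := 1) Metric.isBounded_ball hE
    (fun w hw => by
      rw [frontier_ball (0 : ℂ) one_ne_zero, mem_sphere_zero_iff_norm] at hw
      rw [Complex.norm_exp]
      exact Real.exp_le_one_iff.2 (h w hw))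
    (z := z) (by rw [closure_ball (0 : ℂ) one_ne_zero]; simpa using hz)
  rw [Complex.norm_exp] at key
  exact Real.exp_le_one_iff.1 key

lemma diffContOnCl_one_sub_cpow {ν : ℝ} (hν0 : 0 < ν) :
    DiffContOnCl ℂ (fun z : ℂ => (1 - z) ^ (ν : ℂ)) (Metric.ball 0 1) := by
  refine ⟨fun z hz => ?_, fun z hz => ?_⟩
  · have h1 : ‖z‖ < 1 := by simpa using hz
    have h2 := Complex.re_le_norm z
    refine DifferentiableAt.differentiableWithinAt ?_
    refine DifferentiableAt.cpow_const (by fun_prop) (Or.inl ?_)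
    simp only [Complex.sub_re, Complex.one_re]
    linarith
  · rw [closure_ball (0 : ℂ) one_ne_zero] at hz
    have h1 : ‖z‖ ≤ 1 := by simpa using hz
    have h2 := Complex.re_le_norm z
    have h3 : ContinuousAt (fun w : ℂ => w ^ (ν : ℂ)) (1 - z) :=
      Complex.continuousAt_cpow_const_of_re_pos
        (Or.inl (by simp only [Complex.sub_re, Complex.one_re]; linarith)) (by simpa using hν0)
    exact (ContinuousAt.comp (f := fun z : ℂ => 1 - z) h3 (by fun_prop)).continuousWithinAt

lemma norm_one_sub_sq_of_norm_eq_one {z : ℂ} (hz : ‖z‖ = 1) : ‖1 - z‖ ^ 2 = 2 * (1 - z.re) := by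
  have h : z.re * z.re + z.im * z.im = 1 := by
    rw [← Complex.normSq_apply, Complex.normSq_eq_norm_sq, hz, one_pow]
  rw [← Complex.normSq_eq_norm_sq, Complex.normSq_apply]
  simp only [Complex.sub_re, Complex.one_re, Complex.sub_im, Complex.one_im]
  linarith

lemma re_radial_le_of_sphere_bound {F : ℂ → ℂ} (hF : DiffContOnCl ℂ F (Metric.ball 0 1))
    {ν : ℝ} (hν0 : 0 < ν) (hν1 : ν < 1)
    (h : ∀ ε > 0, ∃ δ > 0, ∀ z : ℂ, ‖z‖ = 1 → ‖1 - z‖ < δ → (F z).re ≤ ε * ‖1 - z‖ ^ ν)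
    {ε : ℝ} (hε : 0 < ε) :
    ∀ᶠ r : ℝ in 𝓝[>] 0, (F ((1 - r : ℝ) : ℂ)).re ≤ ε * r ^ ν := by
  have hcos := cos_pi_mul_div_two_pos hν0.le hν1
  set κ := Real.cos (Real.pi * ν / 2)
  obtain ⟨δ, hδ, hb⟩ := h (ε / 2 * κ) (by positivity)
  have hcont : ContinuousOn F (Metric.closedBall 0 1) := by
    simpa [closure_ball (0 : ℂ) one_ne_zero] using hF.continuousOn
  obtain ⟨K, hK⟩ := (isCompact_closedBall (0 : ℂ) 1).exists_bound_of_continuousOn hcont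
  have hK0 : 0 ≤ K := (norm_nonneg _).trans (hK 0 (by simp))
  set C := K / δ ^ 2
  have hC : 0 ≤ C := by positivity
  have hG : DiffContOnCl ℂ
      (fun z : ℂ => F z - (((ε / 2 : ℝ) : ℂ) • (1 - z) ^ (ν : ℂ) + ((2 * C : ℝ) : ℂ) • (1 - z)))
      (Metric.ball 0 1) := by
    have hlin : DiffContOnCl ℂ (fun z : ℂ => 1 - z) (Metric.ball 0 1) :=
      Differentiable.diffContOnCl (by fun_prop)
    exact hF.sub (((diffContOnCl_one_sub_cpow hν0).const_smul ((ε / 2 : ℝ) : ℂ)).add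
      (hlin.const_smul ((2 * C : ℝ) : ℂ)))
  have hbd : ∀ r : ℝ, 0 < r → r < 1 →
      (F ((1 - r : ℝ) : ℂ)).re ≤ ε / 2 * r ^ ν + 2 * C * r := by
    intro r hr0 hr1
    have := re_nonpos_of_re_nonpos_on_sphere hG (fun z hz => ?_) (z := ((1 - r : ℝ) : ℂ)) ?_
    · have e : (1 : ℂ) - ((1 - r : ℝ) : ℂ) = (r : ℂ) := by push_cast; ring
      rw [e, ← Complex.ofReal_cpow hr0.le] at this
      simp only [smul_eq_mul, Complex.sub_re, Complex.add_re, Complex.re_ofReal_mul,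
        Complex.ofReal_re] at this
      linarith
    · simp only [smul_eq_mul, Complex.sub_re, Complex.add_re, Complex.re_ofReal_mul,
        Complex.one_re]
      have hre : z.re ≤ 1 := hz ▸ Complex.re_le_norm z
      have h1 : κ * ‖1 - z‖ ^ ν ≤ _ := cos_mul_norm_rpow_le_re_cpow hν0.le hν1.le (w := 1 - z)
        (by simp only [Complex.sub_re, Complex.one_re]; linarith)
      have h2 := norm_one_sub_sq_of_norm_eq_one hz
      have h1' := mul_le_mul_of_nonneg_left h1 (by positivity : 0 ≤ ε / 2)
      rcases lt_or_ge ‖1 - z‖ δ with hlt | hge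
      · have h3 := hb z hz hlt
        have h4 : 0 ≤ 2 * C * (1 - z.re) := mul_nonneg (by positivity) (by linarith)
        linarith
      · have h3 : (F z).re ≤ K := (Complex.re_le_norm _).trans (hK z (by simp [hz]))
        have h4 : K ≤ C * ‖1 - z‖ ^ 2 := by
          calc K = C * δ ^ 2 := by simp only [C]; field_simp
            _ ≤ _ := by gcongr
        have h5 : 0 ≤ ε / 2 * (κ * ‖1 - z‖ ^ ν) := by positivity
        rw [h2] at h4
        linarith
    · rw [Complex.norm_real, Real.norm_eq_abs, abs_le]
      constructor <;> linarith
  have hlim : Tendsto (fun r : ℝ => 2 * C * r ^ (1 - ν)) (𝓝[>] 0) (𝓝 0) := by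
    have : ContinuousAt (fun r : ℝ => 2 * C * r ^ (1 - ν)) 0 :=
      continuousAt_const.mul (Real.continuousAt_rpow_const _ _ (Or.inr (by linarith)))
    have h0 := this.tendsto
    rw [Real.zero_rpow (by linarith), mul_zero] at h0
    exact h0.mono_left nhdsWithin_le_nhds
  filter_upwards [hlim.eventually (gt_mem_nhds (half_pos hε)), self_mem_nhdsWithin,
    Ioo_mem_nhdsGT (zero_lt_one' ℝ)] with r hr hr0 hr1
  have hr0 : 0 < r := hr0
  have e : r ^ (1 - ν) * r ^ ν = r := by
    rw [← Real.rpow_add hr0]; simp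
  have h6 := mul_le_mul_of_nonneg_right hr.le (Real.rpow_nonneg hr0.le ν)
  have h7 := hbd r hr0 hr1.2
  rw [mul_assoc, e] at h6
  linarith

lemma abs_arg_le_two_mul_norm_one_sub {z : ℂ} (hz : ‖z‖ = 1) : |z.arg| ≤ 2 * ‖1 - z‖ := by
  have hz0 : z ≠ 0 := by rintro rfl; simp at hz
  have h := Complex.angle_le_mul_norm_sub (x := 1) (y := z) (by simp) hz
  rw [Complex.angle_one_left hz0] at h
  nlinarith [Real.pi_le_four, norm_nonneg (1 - z)]

lemma isLittleO_re_radial_of_isLittleO_re_sphere {F : ℂ → ℂ}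
    (hF : DiffContOnCl ℂ F (Metric.ball 0 1)) {ν : ℝ} (hν0 : 0 < ν) (hν1 : ν < 1)
    (hsymm : ∀ z : ℂ, (F (starRingEnd ℂ z)).re = (F z).re)
    (h : (fun t : ℝ => (F (Complex.exp (Complex.I * t))).re) =o[𝓝[>] 0] fun t : ℝ => t ^ ν) :
    (fun r : ℝ => (F ((1 - r : ℝ) : ℂ)).re) =o[𝓝[>] 0] fun r : ℝ => r ^ ν := by
  have hcont : ContinuousOn F (Metric.closedBall 0 1) := by
    simpa [closure_ball (0 : ℂ) one_ne_zero] using hF.continuousOn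
  have hF1 : (F 1).re = 0 := by
    have hpow : Tendsto (fun t : ℝ => t ^ ν) (𝓝[>] 0) (𝓝 0) := by
      have h0 := (Real.continuousAt_rpow_const 0 ν (Or.inr hν0.le)).tendsto
      rw [Real.zero_rpow hν0.ne'] at h0
      exact h0.mono_left nhdsWithin_le_nhds
    have hl := h.trans_tendsto hpow
    have hexp : Tendsto (fun t : ℝ => Complex.exp (Complex.I * t)) (𝓝[>] 0)
        (𝓝[Metric.closedBall 0 1] 1) := by
      refine tendsto_nhdsWithin_iff.2 ⟨?_, Eventually.of_forall fun t => ?_⟩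
      · have : Continuous fun t : ℝ => Complex.exp (Complex.I * t) := by fun_prop
        have h0 := this.tendsto 0
        simp only [Complex.ofReal_zero, mul_zero, Complex.exp_zero] at h0
        exact h0.mono_left nhdsWithin_le_nhds
      · simp [mul_comm Complex.I, Complex.norm_exp_ofReal_mul_I]
    have hl2 := (Complex.continuous_re.tendsto _).comp ((hcont 1 (by simp)).tendsto.comp hexp)
    exact tendsto_nhds_unique hl2 hl
  have hbound : ∀ ε > 0, ∃ δ > 0, ∀ z : ℂ, ‖z‖ = 1 → ‖1 - z‖ < δ →
      |(F z).re| ≤ ε * ‖1 - z‖ ^ ν := by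
    intro ε hε
    have h1 := h.bound (half_pos hε)
    obtain ⟨η, hη, hs⟩ := mem_nhdsGT_iff_exists_Ioo_subset.1 h1
    have hη : 0 < η := hη
    refine ⟨η / 2, by positivity, fun z hz hzδ => ?_⟩
    have harg := abs_arg_le_two_mul_norm_one_sub hz
    rcases eq_or_ne z.arg 0 with h0 | h0
    · have hz1 : z = 1 := by
        rw [← Complex.norm_mul_exp_arg_mul_I z, h0, hz]; simp
      rw [hz1, hF1, abs_zero]
      positivity
    have hm := hs (show |z.arg| ∈ Set.Ioo 0 η from ⟨abs_pos.2 h0, by linarith⟩)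
    have hval : (F (Complex.exp (Complex.I * (|z.arg| : ℝ)))).re = (F z).re := by
      have hz' : Complex.exp (Complex.I * (z.arg : ℝ)) = z := by
        conv_rhs => rw [← Complex.norm_mul_exp_arg_mul_I z, hz]
        rw [mul_comm]; simp
      rcases abs_choice z.arg with ha | ha
      · rw [ha, hz']
      · rw [ha, ← hsymm]
        congr 2
        rw [← Complex.exp_conj]
        simpa using hz'
    simp only [Set.mem_ofPred_eq, hval, Real.norm_eq_abs] at hm
    rw [abs_of_nonneg (Real.rpow_nonneg (abs_nonneg z.arg) ν)] at hm
    have h2 : |z.arg| ^ ν ≤ 2 * ‖1 - z‖ ^ ν := by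
      calc |z.arg| ^ ν ≤ (2 * ‖1 - z‖) ^ ν := by gcongr
        _ = 2 ^ ν * ‖1 - z‖ ^ ν := Real.mul_rpow (by norm_num) (norm_nonneg _)
        _ ≤ 2 ^ (1 : ℝ) * ‖1 - z‖ ^ ν := by gcongr; norm_num
        _ = _ := by rw [Real.rpow_one]
    nlinarith
  have hup : ∀ ε > 0, ∃ δ > 0, ∀ z : ℂ, ‖z‖ = 1 → ‖1 - z‖ < δ →
      (F z).re ≤ ε * ‖1 - z‖ ^ ν := by
    intro ε hε
    obtain ⟨δ, hδ, H⟩ := hbound ε hε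
    exact ⟨δ, hδ, fun z hz hzδ => (abs_le.1 (H z hz hzδ)).2⟩
  have hlo : ∀ ε > 0, ∃ δ > 0, ∀ z : ℂ, ‖z‖ = 1 → ‖1 - z‖ < δ →
      ((-F) z).re ≤ ε * ‖1 - z‖ ^ ν := by
    intro ε hε
    obtain ⟨δ, hδ, H⟩ := hbound ε hε
    exact ⟨δ, hδ, fun z hz hzδ => by
      simp only [Pi.neg_apply, Complex.neg_re]; linarith [(abs_le.1 (H z hz hzδ)).1]⟩
  refine isLittleO_iff.2 fun ε hε => ?_
  filter_upwards [re_radial_le_of_sphere_bound hF hν0 hν1 hup hε,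
    re_radial_le_of_sphere_bound hF.neg hν0 hν1 hlo hε, self_mem_nhdsWithin] with r h1 h2 hr
  have hr : 0 < r := hr
  rw [Real.norm_eq_abs, Real.norm_eq_abs, abs_of_nonneg (Real.rpow_nonneg hr.le ν), abs_le]
  simp only [Pi.neg_apply, Complex.neg_re] at h2
  constructor <;> linarith

lemma isLittleO_re_one_sub_exp_cpow {ν : ℝ} :
    (fun t : ℝ => ((1 - Complex.exp (Complex.I * t)) ^ (ν : ℂ)).re -
      Real.cos (Real.pi * ν / 2) * t ^ ν) =o[𝓝[>] 0] fun t : ℝ => t ^ ν := by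
  have hder : HasDerivAt (fun t : ℝ => 1 - Complex.exp (Complex.I * t)) (-Complex.I) 0 := by
    have h1 : HasDerivAt (fun t : ℝ => Complex.I * (t : ℂ)) (Complex.I * 1) 0 :=
      (Complex.ofRealCLM.hasDerivAt (x := (0 : ℝ))).const_mul Complex.I
    simpa using (h1.cexp).const_sub 1
  have hslope : Tendsto (fun t : ℝ => t⁻¹ • (1 - Complex.exp (Complex.I * t))) (𝓝[>] 0)
      (𝓝 (-Complex.I)) := by
    have := hder.tendsto_slope_zero_right
    simpa using this
  have hpow : ContinuousAt (fun w : ℂ => (w ^ (ν : ℂ)).re) (-Complex.I) :=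
    Complex.continuous_re.continuousAt.comp
      (continuousAt_cpow_const (Or.inr (by simp)))
  have hlim := hpow.tendsto.comp hslope
  have hval : ((-Complex.I) ^ (ν : ℂ)).re = Real.cos (Real.pi * ν / 2) := by
    rw [Complex.cpow_ofReal_re, Complex.arg_neg_I, norm_neg, Complex.norm_I, Real.one_rpow, one_mul,
      ← Real.cos_neg]
    congr 1; ring
  rw [hval] at hlim
  have h0 : (fun t : ℝ => ((t⁻¹ • (1 - Complex.exp (Complex.I * t))) ^ (ν : ℂ)).re -
      Real.cos (Real.pi * ν / 2)) =o[𝓝[>] 0] fun _ : ℝ => (1 : ℝ) := by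
    rw [isLittleO_one_iff]
    simpa [Function.comp_def] using hlim.sub_const (Real.cos (Real.pi * ν / 2))
  have h1 := h0.mul_isBigO (isBigO_refl (fun t : ℝ => t ^ ν) (𝓝[>] 0))
  refine h1.congr' ?_ (by simp)
  filter_upwards [self_mem_nhdsWithin] with t ht
  have ht : 0 < t := ht
  rw [sub_mul, Complex.cpow_ofReal_re, Complex.cpow_ofReal_re, norm_smul, Complex.real_smul,
    Complex.arg_real_mul _ (inv_pos.2 ht), Real.mul_rpow (norm_nonneg _) (norm_nonneg _),
    Real.norm_of_nonneg (inv_pos.2 ht).le, Real.inv_rpow ht.le]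
  have := (Real.rpow_pos_of_pos ht ν).ne'
  field_simp

lemma DiffContOnCl.conj_conj_unit_ball {f : ℂ → ℂ} (hf : DiffContOnCl ℂ f (Metric.ball 0 1)) :
    DiffContOnCl ℂ (fun z => starRingEnd ℂ (f (starRingEnd ℂ z))) (Metric.ball 0 1) := by
  refine ⟨fun z hz => ?_, ?_⟩
  · have hz' : starRingEnd ℂ z ∈ Metric.ball (0 : ℂ) 1 := by simpa using hz
    have h := (hf.differentiableAt Metric.isOpen_ball hz').conj_conj
    rw [Complex.conj_conj] at h
    exact h.differentiableWithinAt
  · have hc := hf.continuousOn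
    rw [closure_ball (0 : ℂ) one_ne_zero] at hc ⊢
    exact Complex.continuous_conj.comp_continuousOn
      (hc.comp Complex.continuous_conj.continuousOn fun z hz => by simpa using hz)

/-- Let `ψ` be holomorphic on the open unit disk and continuous on the closed unit disk.
If `ψ(e^{it}) = 1 + (c 1_{t>0} + c̄ 1_{t<0}) |t|^ν + o(|t|^ν)` as `t → 0` for some
`ν ∈ (0,1)` and `c` with `Re c ≠ 0`, then with `b = Re(c) sec(πν/2) ∈ ℝ \ {0}` one has
`ψ(1 - r) = 1 + b r^ν + o(r^ν)` as `r ↓ 0`. -/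
theorem stmt_16
    (ψ : ℂ → ℂ)
    (hHolo : DifferentiableOn ℂ ψ (Metric.ball (0 : ℂ) 1))
    (hCont : ContinuousOn ψ (Metric.closedBall (0 : ℂ) 1))
    (ν : ℝ) (hν0 : 0 < ν) (hν1 : ν < 1)
    (c : ℂ) (hc : c.re ≠ 0)
    (hasymp : (fun t : ℝ => ψ (Complex.exp (Complex.I * (t : ℂ))) -
        (1 + (if 0 < t then c else starRingEnd ℂ c) * ((|t| ^ ν : ℝ) : ℂ)))
        =o[𝓝[≠] (0 : ℝ)] fun t : ℝ => |t| ^ ν)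
    (b : ℝ) (hb : b = c.re * (Real.cos (Real.pi * ν / 2))⁻¹) :
    b ≠ 0 ∧
      (fun r : ℝ => ψ (((1 - r : ℝ) : ℂ)) - ((1 + b * r ^ ν : ℝ) : ℂ))
        =o[𝓝[>] (0 : ℝ)] fun r : ℝ => r ^ ν := by
  have hcos := cos_pi_mul_div_two_pos hν0.le hν1
  have hbc : b * Real.cos (Real.pi * ν / 2) = c.re := by
    rw [hb, inv_mul_cancel_right₀ hcos.ne']
  refine ⟨by rw [hb]; exact mul_ne_zero hc (inv_ne_zero hcos.ne'), ?_⟩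
  have hψ : DiffContOnCl ℂ ψ (Metric.ball 0 1) :=
    ⟨hHolo, by rwa [closure_ball (0 : ℂ) one_ne_zero]⟩
  have hψ' := hψ.conj_conj_unit_ball
  set D : ℝ → ℂ := fun t : ℝ => ψ (Complex.exp (Complex.I * (t : ℂ))) -
    (1 + (if 0 < t then c else starRingEnd ℂ c) * ((|t| ^ ν : ℝ) : ℂ)) with hD
  have hpos : D =o[𝓝[>] 0] fun t : ℝ => t ^ ν := by
    refine (hasymp.mono (nhdsWithin_mono 0 fun t ht => ne_of_gt ht)).congr' EventuallyEq.rfl ?_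
    filter_upwards [self_mem_nhdsWithin] with t ht
    rw [abs_of_pos ht]
  have hneg : (fun t => D (-t)) =o[𝓝[>] 0] fun t : ℝ => t ^ ν := by
    have ht : Tendsto (fun t : ℝ => -t) (𝓝[>] 0) (𝓝[≠] 0) := by
      refine tendsto_nhdsWithin_iff.2 ⟨?_, ?_⟩
      · have h0 := (continuous_neg (G := ℝ)).tendsto 0
        rw [neg_zero] at h0
        exact h0.mono_left nhdsWithin_le_nhds
      · filter_upwards [self_mem_nhdsWithin] with t ht
        exact neg_ne_zero.2 (ne_of_gt ht)
    refine (hasymp.comp_tendsto ht).congr' EventuallyEq.rfl ?_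
    filter_upwards [self_mem_nhdsWithin] with t ht
    simp only [Function.comp_apply, abs_neg]
    rw [abs_of_pos ht]
  have hsum := hpos.add hneg
  have hconj : ∀ t : ℝ, starRingEnd ℂ (Complex.exp (Complex.I * t)) =
      Complex.exp (Complex.I * ((-t : ℝ) : ℂ)) := fun t => by
    rw [← Complex.exp_conj]; simp
  have hDsum : ∀ t : ℝ, 0 < t → D t + D (-t) = ψ (Complex.exp (Complex.I * t)) +
      ψ (starRingEnd ℂ (Complex.exp (Complex.I * t))) - 2 -
        ((2 * c.re * t ^ ν : ℝ) : ℂ) := fun t ht => by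
    have hcc : c + starRingEnd ℂ c = ((2 * c.re : ℝ) : ℂ) := Complex.add_conj c
    rw [hconj, Complex.ofReal_mul (2 * c.re), ← hcc]
    simp only [hD, if_pos ht, if_neg (not_lt.2 (neg_nonpos.2 ht.le)), abs_neg, abs_of_pos ht]
    ring
  set F : ℂ → ℂ := fun z => ψ z + starRingEnd ℂ (ψ (starRingEnd ℂ z)) - 2 -
    ((2 * b : ℝ) : ℂ) • (1 - z) ^ (ν : ℂ) with hFdef
  set G : ℂ → ℂ := fun z => (-Complex.I) • (ψ z - starRingEnd ℂ (ψ (starRingEnd ℂ z))) with hGdef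
  have hF : DiffContOnCl ℂ F (Metric.ball 0 1) :=
    ((hψ.add hψ').sub diffContOnCl_const).sub ((diffContOnCl_one_sub_cpow hν0).const_smul ((2 * b : ℝ) : ℂ))
  have hG : DiffContOnCl ℂ G (Metric.ball 0 1) := (hψ.sub hψ').const_smul (-Complex.I)
  have hFre : ∀ z, (F z).re = (ψ z).re + (ψ (starRingEnd ℂ z)).re - 2 -
      2 * b * ((1 - z) ^ (ν : ℂ)).re := fun z => by
    simp only [hFdef, smul_eq_mul, Complex.sub_re, Complex.add_re, Complex.conj_re,
      Complex.re_ofReal_mul, Complex.re_ofNat]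
  have hGre : ∀ z, (G z).re = (ψ z).im + (ψ (starRingEnd ℂ z)).im := fun z => by
    simp [hGdef]
  have hFo := isLittleO_re_radial_of_isLittleO_re_sphere hF hν0 hν1 (fun z => by
    have hn : ‖1 - starRingEnd ℂ z‖ = ‖1 - z‖ := by
      rw [← Complex.norm_conj]; simp
    have ha : |(1 - starRingEnd ℂ z).arg| = |(1 - z).arg| := by
      have : 1 - starRingEnd ℂ z = starRingEnd ℂ (1 - z) := by simp
      rw [this, Complex.arg_conj]
      split_ifs with h
      · rw [h]
      · rw [abs_neg]
    have hp : ((1 - starRingEnd ℂ z) ^ (ν : ℂ)).re = ((1 - z) ^ (ν : ℂ)).re := by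
      rw [Complex.cpow_ofReal_re, Complex.cpow_ofReal_re, hn, ← Real.cos_abs, abs_mul, ha,
        ← abs_mul, Real.cos_abs]
    rw [hFre, hFre, hp, Complex.conj_conj]; ring) (by
    have hre : (fun t => (D t + D (-t)).re) =o[𝓝[>] 0] fun t : ℝ => t ^ ν :=
      (isBigO_of_le _ fun t => Complex.abs_re_le_norm _).trans_isLittleO hsum
    refine (hre.sub ((isLittleO_re_one_sub_exp_cpow (ν := ν)).const_mul_left (2 * b))).congr' ?_
      EventuallyEq.rfl
    filter_upwards [self_mem_nhdsWithin] with t ht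
    rw [hDsum t ht, hFre, ← hbc]
    simp only [Complex.sub_re, Complex.add_re, Complex.re_ofNat, Complex.ofReal_re]
    ring)
  have hGo := isLittleO_re_radial_of_isLittleO_re_sphere hG hν0 hν1 (fun z => by
    rw [hGre, hGre, Complex.conj_conj]; ring) (by
    have him : (fun t => (D t + D (-t)).im) =o[𝓝[>] 0] fun t : ℝ => t ^ ν :=
      (isBigO_of_le _ fun t => Complex.abs_im_le_norm _).trans_isLittleO hsum
    refine him.congr' ?_ EventuallyEq.rfl
    filter_upwards [self_mem_nhdsWithin] with t ht
    rw [hDsum t ht, hGre]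
    simp)
  have hre : (fun r : ℝ => (((1 / 2 * (F ((1 - r : ℝ) : ℂ)).re : ℝ)) : ℂ)) =o[𝓝[>] 0]
      fun r : ℝ => r ^ ν :=
    (isBigO_of_le _ fun t => (Complex.norm_real _).le).trans_isLittleO
      (hFo.const_mul_left (1 / 2))
  have him : (fun r : ℝ => (((1 / 2 * (G ((1 - r : ℝ) : ℂ)).re : ℝ)) : ℂ) * Complex.I) =o[𝓝[>] 0]
      fun r : ℝ => r ^ ν :=
    (isBigO_of_le _ fun t => by simp).trans_isLittleO
      (hGo.const_mul_left (1 / 2))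
  refine (hre.add him).congr' ?_ EventuallyEq.rfl
  filter_upwards [self_mem_nhdsWithin] with r hr
  have hr : 0 < r := hr
  have e : (1 : ℂ) - ((1 - r : ℝ) : ℂ) = (r : ℂ) := by push_cast; ring
  rw [hFre, hGre, Complex.conj_ofReal, e, ← Complex.ofReal_cpow hr.le, Complex.ofReal_re]
  apply Complex.ext
  · simp only [Complex.add_re, Complex.sub_re, Complex.re_ofReal_mul, Complex.I_re,
      Complex.ofReal_re]
    ring
  · simp only [Complex.add_im, Complex.sub_im, Complex.im_ofReal_mul, Complex.I_im,
      Complex.ofReal_im]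
    ring
end
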